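/- arXiv:0711.4739 — 2 statements merged into one kernel-verified Lean document; each statement's English description precedes it below -/
import Mathlib

section
/- Let e be a finite gap set with ℓ gaps. There exists a function x, meromorphic on 𝔻 and regarded as a holomorphic map from 𝔻 into the Riemann sphere ℂ∪{∞}, with the following properties: (i) the range of x is exactly (ℂ∖e)∪{∞}; (ii) x is locally injective; (iii) x(0) = ∞ and lim_{z→0} z·x(z) exists and is a positive real number; (iv) there is a subgroup Γ of Aut(𝔻), isomorphic as an abstract group to the free (non-abelian) group on ℓ generators, such that for all z, w ∈ 𝔻, x(z) = x(w) if and only if there exists γ ∈ Γ with γ(z) = w. Moreover, x with properties (i)–(iv) is unique. -/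
open Filter Set Metric OnePoint

noncomputable section

/-- A finite gap set with `l` gaps: a disjoint union of `l+1` nondegenerate
compact intervals. -/
def IsFiniteGapSetWith (l : ℕ) (e : Set ℝ) : Prop :=
  ∃ α β : Fin (l + 1) → ℝ,
    (∀ j, α j < β j) ∧ (∀ j k, j < k → β j < α k) ∧
    e = ⋃ j, Set.Icc (α j) (β j)

/-- The finite part of a point of the Riemann sphere (`∞` is sent to `0`). -/
def opToC (w : OnePoint ℂ) : ℂ := Option.getD w 0

open Classical in
/-- `x` is "meromorphic" at `z` as a map into the Riemann sphere: near `z` it is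
either given by a holomorphic function, or it has a pole, i.e. it is the reciprocal
of a holomorphic function vanishing at `z`. -/
def MeroSphereAt (x : ℂ → OnePoint ℂ) (z : ℂ) : Prop :=
  (x z ≠ ∞ ∧ ∃ g : ℂ → ℂ, AnalyticAt ℂ g z ∧
    ∀ᶠ w in nhds z, x w = ((g w : ℂ) : OnePoint ℂ)) ∨
  (x z = ∞ ∧ ∃ g : ℂ → ℂ, AnalyticAt ℂ g z ∧ g z = 0 ∧
    ∀ᶠ w in nhds z, x w = if g w = 0 then ∞ else (((g w)⁻¹ : ℂ) : OnePoint ℂ))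

/-- `γ : ℂ → ℂ` restricts to a holomorphic automorphism of the open unit disc. -/
def IsDiscAut (γ : ℂ → ℂ) : Prop :=
  DifferentiableOn ℂ γ (Metric.ball (0 : ℂ) 1) ∧
    Set.BijOn γ (Metric.ball (0 : ℂ) 1) (Metric.ball (0 : ℂ) 1)

/-- The properties (i)–(iv) of the uniformizing covering map
`x : 𝔻 → (ℂ∖e) ∪ {∞}` of Theorem 3.1, with deck transformation group a free
group on `l` generators realized by disc automorphisms. -/
def IsFGCoveringMap (l : ℕ) (e : Set ℝ) (x : ℂ → OnePoint ℂ) : Prop :=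
  (∀ z ∈ Metric.ball (0 : ℂ) 1, MeroSphereAt x z) ∧
  (x '' Metric.ball (0 : ℂ) 1 =
    insert ∞ ((fun c : ℂ => (c : OnePoint ℂ)) '' (Complex.ofReal '' e)ᶜ)) ∧
  (∀ z ∈ Metric.ball (0 : ℂ) 1, ∃ U ∈ nhds z, Set.InjOn x U) ∧
  (x 0 = ∞) ∧
  (∃ c : ℝ, 0 < c ∧ Filter.Tendsto (fun z : ℂ => z * opToC (x z))
      (nhdsWithin 0 {(0 : ℂ)}ᶜ) (nhds (c : ℂ))) ∧
  ∃ ρ : FreeGroup (Fin l) → ℂ → ℂ,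
    (∀ g, IsDiscAut (ρ g)) ∧
    (∀ z ∈ Metric.ball (0 : ℂ) 1, ρ 1 z = z) ∧
    (∀ g h : FreeGroup (Fin l), ∀ z ∈ Metric.ball (0 : ℂ) 1,
      ρ (g * h) z = ρ g (ρ h z)) ∧
    (∀ g h : FreeGroup (Fin l),
      Set.EqOn (ρ g) (ρ h) (Metric.ball (0 : ℂ) 1) → g = h) ∧
    (∀ z ∈ Metric.ball (0 : ℂ) 1, ∀ w ∈ Metric.ball (0 : ℂ) 1,
      (x z = x w ↔ ∃ g : FreeGroup (Fin l), ρ g z = w))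

namespace FGCover
open Topology ComplexConjugate

/-- **Montel's theorem** along an ultrafilter. -/
lemma montel {V : Set ℂ} (hV : IsOpen V) {M : ℝ} (φ : Ultrafilter ℕ) (f : ℕ → ℂ → ℂ)
    (hf : ∀ n, DifferentiableOn ℂ (f n) V) (hb : ∀ n, ∀ z ∈ V, ‖f n z‖ ≤ M) :
    ∃ g : ℂ → ℂ, DifferentiableOn ℂ g V ∧ TendstoLocallyUniformlyOn f g φ V := by
  have hlim : ∀ z : ℂ, ∃ w : ℂ, z ∈ V → Tendsto (fun n => f n z) φ (𝓝 w) := by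
    intro z
    by_cases hz : z ∈ V
    · obtain ⟨w, -, hw⟩ := (isCompact_closedBall (0 : ℂ) M).ultrafilter_le_nhds
        (φ.map fun n => f n z) (by
          rw [le_principal_iff]
          refine Filter.mem_map.2 (Filter.univ_mem' fun n => ?_)
          simpa using hb n z hz)
      exact ⟨w, fun _ => hw⟩
    · exact ⟨0, fun h => absurd h hz⟩
  choose g hg using hlim
  have key : TendstoLocallyUniformlyOn f g φ V := by
    refine tendstoLocallyUniformlyOn_iff.2 ?_
    intro ε hε z hz
    obtain ⟨r, hr, hrV⟩ := Metric.isOpen_iff.1 hV z hz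
    have lip : ∀ n, ∀ w ∈ ball z r, dist (f n w) (f n z) ≤ 2 * M / r * dist w z := by
      intro n w hw
      refine Complex.dist_le_div_mul_dist_of_mapsTo_ball ((hf n).mono hrV) ?_ hw
      intro u hu
      rw [mem_closedBall, dist_eq_norm]
      calc ‖f n u - f n z‖ ≤ ‖f n u‖ + ‖f n z‖ := norm_sub_le _ _
        _ ≤ 2 * M := by linarith [hb n u (hrV hu), hb n z hz]
    have hM : 0 ≤ M := (norm_nonneg _).trans (hb 0 z hz)
    have lipg : ∀ w ∈ ball z r, dist (g w) (g z) ≤ 2 * M / r * dist w z := fun w hw =>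
      le_of_tendsto ((hg w (hrV hw)).dist (hg z hz)) (Eventually.of_forall fun n => lip n w hw)
    set L := 2 * M / r with hL
    have hL0 : 0 ≤ L := by positivity
    have hδ : 0 < min r (ε / (3 * (L + 1))) := by positivity
    refine ⟨ball z (min r (ε / (3 * (L + 1)))), mem_nhdsWithin_of_mem_nhds (ball_mem_nhds _ hδ), ?_⟩
    filter_upwards [(tendsto_iff_dist_tendsto_zero.1 (hg z hz)).eventually
      (gt_mem_nhds (show (0 : ℝ) < ε / 3 by positivity))] with n hn w hw
    have hwr : w ∈ ball z r := ball_subset_ball (min_le_left _ _) hw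
    have h3 : L * dist w z ≤ ε / 3 := by
      have h4 : dist w z < ε / (3 * (L + 1)) := lt_of_lt_of_le hw (min_le_right _ _)
      have h5 : (L + 1) * dist w z ≤ (L + 1) * (ε / (3 * (L + 1))) := by gcongr
      have h6 : (L + 1) * (ε / (3 * (L + 1))) = ε / 3 := by field_simp
      nlinarith [dist_nonneg (x := w) (y := z)]
    have h1 := lip n w hwr
    have h2 := lipg w hwr
    have := dist_triangle4 (g w) (g z) (f n z) (f n w)
    rw [dist_comm (g z), dist_comm (f n z) (f n w)] at this
    linarith
  exact ⟨g, key.differentiableOn (Eventually.of_forall hf) hV, key⟩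

/-- A weak form of **Hurwitz's theorem**. -/
lemma ne_of_tendstoLocallyUniformlyOn {V : Set ℂ} (hV : IsOpen V) (hVc : IsPreconnected V)
    {φ : Filter ℕ} [φ.NeBot] {f : ℕ → ℂ → ℂ} {g : ℂ → ℂ} {b : ℂ}
    (hf : ∀ n, DifferentiableOn ℂ (f n) V) (hfb : ∀ n, ∀ z ∈ V, f n z ≠ b)
    (hg : DifferentiableOn ℂ g V) (h : TendstoLocallyUniformlyOn f g φ V)
    {z₁ : ℂ} (hz₁ : z₁ ∈ V) (hgz₁ : g z₁ ≠ b) {z₀ : ℂ} (hz₀ : z₀ ∈ V) : g z₀ ≠ b := by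
  intro hb
  have han : AnalyticOnNhd ℂ (fun z => g z - b) V := (hg.sub_const b).analyticOnNhd hV
  have hev : ∀ᶠ z in 𝓝[≠] z₀, g z - b ≠ 0 := by
    refine (han z₀ hz₀).eventually_eq_zero_or_eventually_ne_zero.resolve_left fun h0 => ?_
    have := han.eqOn_zero_of_preconnected_of_eventuallyEq_zero hVc hz₀ h0 hz₁
    exact hgz₁ (sub_eq_zero.1 this)
  obtain ⟨ε, hε, hεV⟩ := Metric.mem_nhds_iff.1
    (Filter.inter_mem (hV.mem_nhds hz₀) (eventually_nhdsWithin_iff.1 hev))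
  have hsub : closedBall z₀ (ε / 2) ⊆ ball z₀ ε := closedBall_subset_ball (by linarith)
  have hcV : closedBall z₀ (ε / 2) ⊆ V := fun z hz => (hεV (hsub hz)).1
  have hsV : sphere z₀ (ε / 2) ⊆ V := sphere_subset_closedBall.trans hcV
  have hne : ∀ z ∈ sphere z₀ (ε / 2), g z - b ≠ 0 := by
    intro z hz
    refine (hεV (hsub (sphere_subset_closedBall hz))).2 ?_
    rintro rfl
    simp at hz
    linarith
  obtain ⟨w, hw, hwmin⟩ := (isCompact_sphere z₀ (ε / 2)).exists_isMinOn
    (NormedSpace.sphere_nonempty.2 (by positivity))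
    (((hg.continuousOn.mono hsV).sub continuousOn_const).norm)
  set δ := ‖g w - b‖ with hδ
  have hδ0 : 0 < δ := norm_pos_iff.2 (hne w hw)
  have hunif : TendstoUniformlyOn f g φ (sphere z₀ (ε / 2)) :=
    (tendstoLocallyUniformlyOn_iff_tendstoUniformlyOn_of_compact (isCompact_sphere _ _)).1
      (h.mono hsV)
  have hev2 := Metric.tendstoUniformlyOn_iff.1 hunif (δ / 2) (by positivity)
  have hlow : ∀ᶠ n in φ, δ / 2 ≤ ‖f n z₀ - b‖ := by
    filter_upwards [hev2] with n hn
    have hD : DiffContOnCl ℂ (fun z => (f n z - b)⁻¹) (ball z₀ (ε / 2)) := by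
      refine DifferentiableOn.diffContOnCl ?_
      rw [closure_ball _ (by positivity)]
      exact (((hf n).mono hcV).sub_const b).inv fun z hz => sub_ne_zero.2 (hfb n z (hcV hz))
    have := Complex.norm_le_of_forall_mem_frontier_norm_le (C := (δ / 2)⁻¹) isBounded_ball hD
      (fun z hz => by
        rw [frontier_ball _ (by positivity)] at hz
        rw [norm_inv]
        have h1 : δ ≤ ‖g z - b‖ := hwmin hz
        have h2 := hn z hz
        rw [dist_eq_norm] at h2
        have h3 : ‖g z - b‖ ≤ ‖g z - f n z‖ + ‖f n z - b‖ := by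
          simpa using norm_add_le (g z - f n z) (f n z - b)
        gcongr
        linarith) (subset_closure (mem_ball_self (by positivity)))
    rw [norm_inv] at this
    exact (inv_le_inv₀ (norm_pos_iff.2 (sub_ne_zero.2 (hfb n z₀ hz₀))) (by positivity)).1 this
  have hl : Tendsto (fun n => ‖f n z₀ - b‖) φ (𝓝 ‖g z₀ - b‖) :=
    ((h.tendsto_at hz₀).sub_const b).norm
  have := ge_of_tendsto hl hlow
  rw [hb, sub_self, norm_zero] at this
  linarith

/-- The disc automorphism `z ↦ (z + a) / (1 + conj a * z)`. -/
def mob (a z : ℂ) : ℂ := (z + a) / (1 + conj a * z)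

lemma mob_den_ne {a z : ℂ} (ha : ‖a‖ < 1) (hz : ‖z‖ < 1) : 1 + conj a * z ≠ 0 := by
  intro h
  have : ‖conj a * z‖ = 1 := by
    rw [← norm_neg, ← eq_neg_of_add_eq_zero_left h, norm_one]
  rw [norm_mul, RCLike.norm_conj] at this
  nlinarith [norm_nonneg a, norm_nonneg z]

lemma normSq_mob_den (a z : ℂ) : ‖1 + conj a * z‖ ^ 2 - ‖z + a‖ ^ 2
    = (1 - ‖a‖ ^ 2) * (1 - ‖z‖ ^ 2) := by
  simp only [← Complex.normSq_eq_norm_sq, Complex.normSq_apply]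
  simp
  ring

lemma norm_mob_lt {a z : ℂ} (ha : ‖a‖ < 1) (hz : ‖z‖ < 1) : ‖mob a z‖ < 1 := by
  rw [mob, norm_div, div_lt_one (norm_pos_iff.2 (mob_den_ne ha hz))]
  have := normSq_mob_den a z
  have h1 : 0 < (1 - ‖a‖ ^ 2) * (1 - ‖z‖ ^ 2) := by
    apply mul_pos <;> nlinarith [norm_nonneg a, norm_nonneg z]
  exact lt_of_pow_lt_pow_left₀ 2 (norm_nonneg _) (by linarith)

lemma mob_neg_mob {a z : ℂ} (ha : ‖a‖ < 1) (hz : ‖z‖ < 1) : mob (-a) (mob a z) = z := by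
  have h1 := mob_den_ne ha hz
  have h2 : (1 : ℂ) - conj a * a ≠ 0 := by
    have := mob_den_ne (a := -a) (z := a) (by simpa using ha) ha
    simpa [sub_eq_add_neg] using this
  have h3 := mob_den_ne (a := -a) (z := mob a z) (by simpa using ha) (norm_mob_lt ha hz)
  rw [mob, div_eq_iff h3]
  have h4 : mob a z * (1 + conj a * z) = z + a := div_mul_cancel₀ _ h1
  refine mul_right_cancel₀ h1 ?_
  simp only [map_neg]
  linear_combination (1 + z * conj a) * h4

lemma mob_mob_neg {a z : ℂ} (ha : ‖a‖ < 1) (hz : ‖z‖ < 1) : mob a (mob (-a) z) = z := by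
  simpa using mob_neg_mob (a := -a) (by simpa using ha) hz

lemma differentiableAt_mob {a z : ℂ} (ha : ‖a‖ < 1) (hz : ‖z‖ < 1) :
    DifferentiableAt ℂ (mob a) z := by
  have := mob_den_ne ha hz
  unfold mob
  fun_prop (disch := assumption)

lemma norm_mob_le {a z : ℂ} {s t : ℝ} (ha : ‖a‖ ≤ s) (hs : s < 1) (hz : ‖z‖ ≤ t) (ht : t < 1) :
    ‖mob a z‖ ≤ (t + s) / (1 + s * t) := by
  have hs0 := (norm_nonneg a).trans ha
  have ht0 := (norm_nonneg z).trans hz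
  rw [mob, norm_div, div_le_div_iff₀ (norm_pos_iff.2 (mob_den_ne (ha.trans_lt hs) (hz.trans_lt ht)))
    (by positivity)]
  have h1 := normSq_mob_den a z
  refine le_of_sq_le_sq ?_ (by positivity)
  have h2 : (1 - s ^ 2) * (1 - t ^ 2) ≤ (1 - ‖a‖ ^ 2) * (1 - ‖z‖ ^ 2) := by
    have : ‖a‖ ^ 2 ≤ s ^ 2 := by gcongr
    have : ‖z‖ ^ 2 ≤ t ^ 2 := by gcongr
    have : s ^ 2 < 1 := by nlinarith
    have : t ^ 2 < 1 := by nlinarith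
    gcongr
    linarith
  have h4 : ‖z + a‖ ≤ t + s := (norm_add_le _ _).trans (by linarith)
  have h5 : ‖z + a‖ ^ 2 ≤ (t + s) ^ 2 := by gcongr
  have h6 : (1 + s * t) ^ 2 - (t + s) ^ 2 = (1 - s ^ 2) * (1 - t ^ 2) := by ring
  have h7 : ‖1 + conj a * z‖ ^ 2 = ‖z + a‖ ^ 2 + (1 - ‖a‖ ^ 2) * (1 - ‖z‖ ^ 2) := by linarith
  rw [mul_pow, mul_pow, h7]
  have h8 : (1 + s * t) ^ 2 = (t + s) ^ 2 + (1 - s ^ 2) * (1 - t ^ 2) := by linarith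
  rw [h8]
  have h9 : 0 ≤ (1 - s ^ 2) * (1 - t ^ 2) := by
    apply mul_nonneg <;> nlinarith
  nlinarith [sq_nonneg (t + s), sq_nonneg ‖z + a‖,
    mul_le_mul h5 h2 h9 (sq_nonneg _)]

/-- Every nonvanishing holomorphic function on `V` has a holomorphic square root. -/
def HasSqrts (V : Set ℂ) : Prop :=
  ∀ f : ℂ → ℂ, DifferentiableOn ℂ f V → (∀ z ∈ V, f z ≠ 0) →
    ∃ g : ℂ → ℂ, DifferentiableOn ℂ g V ∧ ∀ z ∈ V, g z ^ 2 = f z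

/-- `p : U → Ω` is holomorphic and through each point of `U` over `V i` passes a holomorphic
section of `p` defined on all of `V i`. -/
structure SectionCover {ι : Type*} (V : ι → Set ℂ) (Ω U : Set ℂ) (p : ℂ → ℂ) : Prop where
  diff : DifferentiableOn ℂ p U
  maps : MapsTo p U Ω
  sec : ∀ i, ∀ z ∈ U, p z ∈ V i → ∃ q : ℂ → ℂ, DifferentiableOn ℂ q (V i) ∧
    MapsTo q (V i) U ∧ (∀ y ∈ V i, p (q y) = y) ∧ q (p z) = z

/-- The degree two Blaschke product fixing the origin with critical value `-b ^ 2`. -/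
def sqmob (b z : ℂ) : ℂ := mob (-b ^ 2) (mob b z ^ 2)

lemma norm_sq_lt {b : ℂ} (hb : ‖b‖ < 1) : ‖b ^ 2‖ < 1 := by
  rw [norm_pow]
  exact pow_lt_one₀ (norm_nonneg _) hb two_ne_zero

lemma sqmob_eq {b z : ℂ} (hb : ‖b‖ < 1) (hz : ‖z‖ < 1) :
    sqmob b z = z * mob b (mob b z) := by
  have hw := norm_mob_lt hb hz
  have h0 := mob_neg_mob hb hz
  rw [sqmob]
  generalize mob b z = w at *
  rw [← h0]
  have h1 := mob_den_ne hb hw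
  have h2 := mob_den_ne (a := -b) (by simpa using hb) hw
  have h3 := mob_den_ne (a := -b ^ 2) (by simpa using norm_sq_lt hb) (norm_sq_lt hw)
  rw [mob, mob, mob, div_mul_div_comm, div_eq_div_iff h3 (mul_ne_zero h2 h1)]
  simp only [map_neg, map_pow]
  ring

lemma sqmob_zero {b : ℂ} (hb : ‖b‖ < 1) : sqmob b 0 = 0 := by
  rw [sqmob_eq hb (by simp), zero_mul]

lemma differentiableAt_sqmob {b z : ℂ} (hb : ‖b‖ < 1) (hz : ‖z‖ < 1) :
    DifferentiableAt ℂ (sqmob b) z := by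
  have h1 : DifferentiableAt ℂ (fun z => mob b z ^ 2) z := (differentiableAt_mob hb hz).pow 2
  exact DifferentiableAt.comp z (differentiableAt_mob (a := -b ^ 2) (by simpa using norm_sq_lt hb)
    (norm_sq_lt (norm_mob_lt hb hz))) h1

/-- The growth factor in the square root trick. -/
def growth (t : ℝ) : ℝ :=
  t * (((t + √t) / (1 + √t * t) + √t) / (1 + √t * ((t + √t) / (1 + √t * t))))

lemma add_div_one_add_mul_lt {s t : ℝ} (hs0 : 0 ≤ s) (hs : s < 1) (ht0 : 0 ≤ t) (ht : t < 1) :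
    (t + s) / (1 + s * t) < 1 := by
  rw [div_lt_one (by positivity)]
  nlinarith

lemma sqrt_lt_one' {t : ℝ} (ht : t < 1) : √t < 1 := by
  rw [Real.sqrt_lt' one_pos]
  simpa using ht

lemma growth_lt {t : ℝ} (h0 : 0 < t) (h1 : t < 1) : growth t < t := by
  have hs := Real.sqrt_nonneg t
  have hs1 := sqrt_lt_one' h1
  have := add_div_one_add_mul_lt hs hs1 (t := (t + √t) / (1 + √t * t)) (by positivity)
    (add_div_one_add_mul_lt hs hs1 h0.le h1)
  unfold growth
  nlinarith

lemma continuousAt_growth {t : ℝ} (h0 : 0 < t) : ContinuousAt growth t := by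
  have hs := Real.sqrt_nonneg t
  have h1 : 1 + √t * t ≠ 0 := by positivity
  have h2 : 1 + √t * ((t + √t) / (1 + √t * t)) ≠ 0 := by positivity
  unfold growth
  fun_prop (disch := assumption)

lemma norm_sqmob_le {b z : ℂ} {t : ℝ} (ht : t < 1) (hb : ‖b ^ 2‖ ≤ t) (hz : ‖z‖ ≤ t) :
    ‖sqmob b z‖ ≤ growth t := by
  have ht0 := (norm_nonneg z).trans hz
  have hs := Real.sqrt_nonneg t
  have hs1 := sqrt_lt_one' ht
  have hb' : ‖b‖ ≤ √t := by
    apply Real.le_sqrt_of_sq_le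
    rwa [← norm_pow]
  have h1 := norm_mob_le hb' hs1 hz ht
  have h2 := norm_mob_le hb' hs1 h1 (add_div_one_add_mul_lt hs hs1 ht0 ht)
  rw [sqmob_eq (hb'.trans_lt hs1) (hz.trans_lt ht), norm_mul]
  unfold growth
  gcongr

namespace SectionCover
variable {ι : Type*} {V : ι → Set ℂ} {Ω U : Set ℂ} {p : ℂ → ℂ}

lemma comp_sqmob (hc : SectionCover V Ω U p) (hs : ∀ i, HasSqrts (V i)) (hU : U ⊆ ball 0 1)
    {b : ℂ} (hb : ‖b‖ < 1) (hbU : -b ^ 2 ∉ U) :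
    SectionCover V Ω (ball 0 1 ∩ sqmob b ⁻¹' U) (p ∘ sqmob b) where
  diff := fun z hz => by
    have hz1 : ‖z‖ < 1 := by simpa using hz.1
    exact (hc.diff _ hz.2).comp z (differentiableAt_sqmob hb hz1).differentiableWithinAt
      fun w hw => hw.2
  maps := fun z hz => hc.maps hz.2
  sec := by
    intro i z ⟨hz, hzU⟩ hpz
    rw [Function.comp_apply] at hpz
    have hz1 : ‖z‖ < 1 := by simpa using hz
    obtain ⟨q, hqd, hqU, hpq, hqz⟩ := hc.sec i _ hzU hpz
    have ha : ‖-b ^ 2‖ < 1 := by simpa using norm_sq_lt hb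
    have ha' : ‖-(-b ^ 2)‖ < 1 := by simpa using norm_sq_lt hb
    have hq1 : ∀ y ∈ V i, ‖q y‖ < 1 := fun y hy => by simpa using hU (hqU hy)
    obtain ⟨t, htd, ht⟩ := hs i (fun y => mob (-(-b ^ 2)) (q y))
      (fun y hy => (differentiableAt_mob ha' (hq1 y hy)).comp_differentiableWithinAt y (hqd y hy))
      (fun y hy h0 => by
        have := mob_mob_neg ha (hq1 y hy)
        rw [h0] at this
        apply hbU
        have h2 := hqU hy
        rw [← this] at h2
        simpa [mob] using h2)
    have ht1 : ∀ y ∈ V i, ‖t y‖ < 1 := by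
      intro y hy
      have := norm_mob_lt ha' (hq1 y hy)
      rw [← ht y hy, norm_pow] at this
      exact (pow_lt_one_iff_of_nonneg (norm_nonneg _) two_ne_zero).1 this
    have hsq : t (p (sqmob b z)) ^ 2 = mob b z ^ 2 := by
      rw [ht _ hpz, hqz, sqmob]
      exact mob_neg_mob ha (norm_sq_lt (norm_mob_lt hb hz1))
    obtain ⟨ε, hε, hεt⟩ : ∃ ε : ℂ, (ε ^ 2 = 1 ∧ ‖ε‖ = 1) ∧ ε * t (p (sqmob b z)) = mob b z := by
      rcases sq_eq_sq_iff_eq_or_eq_neg.1 hsq with h | h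
      · exact ⟨1, by simp, by simpa using h⟩
      · exact ⟨-1, by simp, by simp [h]⟩
    have hb' : ‖-b‖ < 1 := by simpa using hb
    have hεt1 : ∀ y ∈ V i, ‖ε * t y‖ < 1 := fun y hy => by
      rw [norm_mul, hε.2, one_mul]; exact ht1 y hy
    have key : ∀ y ∈ V i, sqmob b (mob (-b) (ε * t y)) = q y := by
      intro y hy
      rw [sqmob, mob_mob_neg hb (hεt1 y hy), mul_pow, hε.1, one_mul, ht y hy,
        mob_mob_neg ha (hq1 y hy)]
    refine ⟨fun y => mob (-b) (ε * t y), fun y hy => ?_, fun y hy => ⟨?_, ?_⟩, fun y hy => ?_, ?_⟩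
    · exact (differentiableAt_mob hb' (hεt1 y hy)).comp_differentiableWithinAt y
        ((htd y hy).const_mul ε)
    · simpa using norm_mob_lt hb' (hεt1 y hy)
    · rw [mem_preimage, key y hy]
      exact hqU hy
    · rw [Function.comp_apply, key y hy, hpq y hy]
    · simp only [Function.comp_apply]
      rw [hεt, mob_neg_mob hb hz1]

end SectionCover

/-- Radii `r` such that some section cover is defined at least on the disc of radius `r`. -/
def coverRadii {ι : Type*} (V : ι → Set ℂ) (Ω : Set ℂ) : Set ℝ :=
  {r | r < 1 ∧ ∃ U p, SectionCover V Ω U p ∧ U ⊆ ball 0 1 ∧ p 0 = 0 ∧ ball 0 r ⊆ U}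

lemma mem_coverRadii {ι : Type*} {V : ι → Set ℂ} {Ω : Set ℂ} (hs : ∀ i, HasSqrts (V i))
    (hΩ : IsOpen Ω) (h0 : (0 : ℂ) ∈ Ω) (hΩ1 : Ω ⊆ ball 0 1) (hVΩ : ∀ i, V i ⊆ Ω)
    {r : ℝ} (hr : r < 1) : r ∈ coverRadii V Ω := by
  have hinit : SectionCover V Ω Ω id :=
    ⟨differentiableOn_id, mapsTo_id _, fun i z _ hz =>
      ⟨id, differentiableOn_id, hVΩ i, fun _ _ => rfl, rfl⟩⟩
  obtain ⟨ε, hε, hεΩ⟩ := Metric.isOpen_iff.1 hΩ 0 h0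
  have hne : min ε (1 / 2) ∈ coverRadii V Ω :=
    ⟨(min_le_right _ _).trans_lt (by norm_num), Ω, id, hinit, hΩ1, rfl,
      (ball_subset_ball (min_le_left _ _)).trans hεΩ⟩
  have hbdd : BddAbove (coverRadii V Ω) := ⟨1, fun r hr => hr.1.le⟩
  have hR0 : 0 < sSup (coverRadii V Ω) :=
    (show 0 < min ε (1 / 2) by positivity).trans_le (le_csSup hbdd hne)
  have hR : 1 ≤ sSup (coverRadii V Ω) := by
    by_contra! hR1
    set R := sSup (coverRadii V Ω)
    have h1 : ∀ᶠ t in 𝓝 R, growth t < R ∧ t < 1 :=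
      ((continuousAt_growth hR0).eventually_lt_const (growth_lt hR0 hR1)).and (gt_mem_nhds hR1)
    have hev : ∀ᶠ t in 𝓝[>] R, (growth t < R ∧ t < 1) ∧ R < t :=
      (h1.filter_mono nhdsWithin_le_nhds).and self_mem_nhdsWithin
    obtain ⟨t, ⟨ht, ht1⟩, hRt⟩ := hev.exists
    have htS : t ∉ coverRadii V Ω := fun h => (le_csSup hbdd h).not_gt hRt
    obtain ⟨r, ⟨hr1, U, p, hc, hU, hp0, hrU⟩, htr⟩ := exists_lt_of_lt_csSup ⟨_, hne⟩ ht
    have : ¬ ball 0 t ⊆ U := fun h => htS ⟨ht1, U, p, hc, hU, hp0, h⟩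
    obtain ⟨a, ha, haU⟩ := not_subset.1 this
    obtain ⟨b, hb⟩ := IsAlgClosed.exists_pow_nat_eq (-a) (n := 2) two_pos
    have hat : ‖a‖ < t := by simpa using ha
    have hbt : ‖b ^ 2‖ ≤ t := by rw [hb, norm_neg]; exact hat.le
    have hb1 : ‖b‖ < 1 := by
      have : ‖b‖ ^ 2 < 1 := by rw [← norm_pow, hb, norm_neg]; exact hat.trans ht1
      exact (pow_lt_one_iff_of_nonneg (norm_nonneg _) two_ne_zero).1 this
    refine htS ⟨ht1, _, _, hc.comp_sqmob hs hU hb1 (by rwa [hb, neg_neg]),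
      inter_subset_left, ?_, ?_⟩
    · rw [Function.comp_apply, sqmob_zero hb1, hp0]
    · intro z hz
      have hz' : ‖z‖ < t := by simpa using hz
      refine ⟨ball_subset_ball ht1.le hz, hrU ?_⟩
      rw [mem_ball_zero_iff]
      exact (norm_sqmob_le ht1 hbt hz'.le).trans_lt htr
  obtain ⟨r', ⟨-, U, p, hc, hU, hp0, hrU⟩, hrr'⟩ := exists_lt_of_lt_csSup ⟨_, hne⟩ (hr.trans_le hR)
  exact ⟨hr, U, p, hc, hU, hp0, (ball_subset_ball hrr'.le).trans hrU⟩

/-- Uniformization: a plane domain inside the disc covered by simply connected pieces is the image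
of the disc under a map which has holomorphic sections over the pieces. -/
theorem exists_sectionCover_ball {ι : Type*} {V : ι → Set ℂ} {Ω : Set ℂ}
    (hs : ∀ i, HasSqrts (V i)) (hVo : ∀ i, IsOpen (V i)) (hVc : ∀ i, IsPreconnected (V i))
    (hΩ : IsOpen Ω) (h0 : (0 : ℂ) ∈ Ω) (hΩ1 : Ω ⊆ ball 0 1) (hVΩ : ∀ i, V i ⊆ Ω) :
    ∃ p, SectionCover V Ω (ball 0 1) p ∧ p 0 = 0 := by
  let r : ℕ → ℝ := fun n => 1 - 1 / ((n : ℝ) + 2)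
  have hr1 : ∀ n, r n < 1 := fun n => by
    have : 0 < 1 / ((n : ℝ) + 2) := by positivity
    simp only [r]; linarith
  have hr0 : ∀ n, 0 < r n := fun n => by
    have : 1 / ((n : ℝ) + 2) < 1 := by
      rw [div_lt_one (by positivity)]
      linarith [(Nat.cast_nonneg n : (0 : ℝ) ≤ n)]
    simp only [r]; linarith
  have hrt : Tendsto r atTop (𝓝 1) := by
    have h1 : Tendsto (fun n : ℕ => 1 / ((n : ℝ) + 2)) atTop (𝓝 0) :=
      tendsto_const_nhds.div_atTop (tendsto_atTop_add_const_right _ _ tendsto_natCast_atTop_atTop)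
    simpa [r] using h1.const_sub 1
  choose hr1' U P hc hU hP0 hrU using fun n => mem_coverRadii hs hΩ h0 hΩ1 hVΩ (hr1 n)
  let φ : Ultrafilter ℕ := hyperfilter ℕ
  have hφ : (φ : Filter ℕ) ≤ atTop := Nat.hyperfilter_le_atTop
  have hrφ : Tendsto (fun n => (r n : ℂ)) φ (𝓝 1) := by
    exact_mod_cast (Complex.continuous_ofReal.tendsto 1).comp (hrt.mono_left hφ)
  let F : ℕ → ℂ → ℂ := fun n z => P n (r n * z)
  have hmul : ∀ n, ∀ z ∈ ball (0 : ℂ) 1, (r n : ℂ) * z ∈ U n := fun n z hz => by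
    apply hrU n
    rw [mem_ball_zero_iff] at hz ⊢
    rw [norm_mul, Complex.norm_real, Real.norm_of_nonneg (hr0 n).le]
    nlinarith [hr0 n]
  have hFd : ∀ n, DifferentiableOn ℂ (F n) (ball 0 1) := fun n =>
    (hc n).diff.comp (by fun_prop) (hmul n)
  have hFΩ : ∀ n, ∀ z ∈ ball (0 : ℂ) 1, F n z ∈ Ω := fun n z hz => (hc n).maps (hmul n z hz)
  have hb1 : ∀ z ∈ ball (0 : ℂ) 1, ‖z‖ ≤ 1 := fun z hz => (mem_ball_zero_iff.1 hz).le
  obtain ⟨p, hpd, hp⟩ := montel isOpen_ball φ F hFd fun n z hz => hb1 _ (hΩ1 (hFΩ n z hz))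
  have h0b : (0 : ℂ) ∈ ball (0 : ℂ) 1 := mem_ball_self one_pos
  have hp0 : p 0 = 0 := by
    have h1 := hp.tendsto_at h0b
    simp only [F, mul_zero, hP0] at h1
    exact tendsto_nhds_unique h1 tendsto_const_nhds
  have hpΩ : MapsTo p (ball 0 1) Ω := fun z hz => by
    by_contra hcon
    exact ne_of_tendstoLocallyUniformlyOn isOpen_ball (convex_ball _ _).isPreconnected hFd
      (fun n w hw h => hcon (by rw [← h]; exact hFΩ n w hw)) hpd hp h0b
      (fun h => hcon (by rw [← h, hp0]; exact h0))
      hz rfl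
  have htc : ∀ {u : ℕ → ℂ} {z}, z ∈ ball (0 : ℂ) 1 → Tendsto u φ (𝓝 z) →
      Tendsto (fun n => F n (u n)) φ (𝓝 (p z)) := fun {u z} hz hu =>
    hp.tendsto_comp (hpd.continuousOn z hz) hz (tendsto_nhdsWithin_iff.2
      ⟨hu, hu.eventually (isOpen_ball.mem_nhds hz)⟩)
  refine ⟨p, ⟨hpd, hpΩ, fun i z hz hpz => ?_⟩, hp0⟩
  have hev : ∀ᶠ n in φ, F n z ∈ V i := (hp.tendsto_at hz).eventually ((hVo i).mem_nhds hpz)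
  have hq : ∀ n, ∃ q : ℂ → ℂ, DifferentiableOn ℂ q (V i) ∧ (∀ y ∈ V i, ‖q y‖ ≤ 1) ∧
      (F n z ∈ V i → (∀ y ∈ V i, P n (q y) = y) ∧ q (F n z) = r n * z) := by
    intro n
    by_cases h : F n z ∈ V i
    · obtain ⟨q, h1, h2, h3, h4⟩ := (hc n).sec i _ (hmul n z hz) h
      exact ⟨q, h1, fun y hy => hb1 _ (hU n (h2 hy)), fun _ => ⟨h3, h4⟩⟩
    · exact ⟨0, differentiableOn_const 0, by simp, fun h' => absurd h' h⟩
  choose Q hQd hQb hQ using hq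
  obtain ⟨q, hqd, hq⟩ := montel (hVo i) φ Q hQd hQb
  have hqz : q (p z) = z := by
    have h1 : Tendsto (fun n => Q n (F n z)) φ (𝓝 (q (p z))) :=
      hq.tendsto_comp (hqd.continuousOn _ hpz) hpz (tendsto_nhdsWithin_iff.2
        ⟨hp.tendsto_at hz, hev⟩)
    have h2 : Tendsto (fun n => (r n : ℂ) * z) φ (𝓝 z) := by simpa using hrφ.mul_const z
    refine tendsto_nhds_unique h1 (h2.congr' ?_)
    filter_upwards [hev] with n hn
    exact ((hQ n hn).2).symm
  have hqle : ∀ y ∈ V i, ‖q y‖ ≤ 1 := fun y hy =>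
    le_of_tendsto (hq.tendsto_at hy).norm (Eventually.of_forall fun n => hQb n y hy)
  have hqlt : MapsTo q (V i) (ball 0 1) := fun y hy => by
    rw [mem_ball_zero_iff]
    refine lt_of_le_of_ne (hqle y hy) fun h1 => ?_
    have := Complex.norm_eqOn_of_isPreconnected_of_isMaxOn (hVc i) (hVo i) hqd hy
      (fun w hw => by simpa [h1] using hqle w hw) hpz
    simp only [Function.comp_apply, hqz, Function.const_apply, h1] at this
    rw [mem_ball_zero_iff] at hz
    linarith
  refine ⟨q, hqd, hqlt, fun y hy => ?_, hqz⟩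
  have h1 : Tendsto (fun n => Q n y / r n) φ (𝓝 (q y)) := by
    simpa [Pi.div_def] using (hq.tendsto_at hy).div hrφ one_ne_zero
  refine tendsto_nhds_unique (htc (hqlt hy) h1) (tendsto_const_nhds.congr' ?_)
  filter_upwards [hev] with n hn
  have : (r n : ℂ) ≠ 0 := by exact_mod_cast (hr0 n).ne'
  simp only [F]
  rw [mul_div_cancel₀ _ this, (hQ n hn).1 y hy]

/-- An injective holomorphic function has nonvanishing derivative. -/
lemma deriv_ne_zero_of_injOn {p : ℂ → ℂ} {N : Set ℂ} {z₀ : ℂ} (hN : N ∈ 𝓝 z₀)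
    (hp : DifferentiableOn ℂ p N) (hinj : InjOn p N) : deriv p z₀ ≠ 0 := by
  have hpan : AnalyticAt ℂ p z₀ := hp.analyticAt hN
  have hnc : ¬ ∀ᶠ z in 𝓝 z₀, p z = p z₀ := by
    intro h
    obtain ⟨r, hr, hrN⟩ := Metric.mem_nhds_iff.1 (inter_mem hN h)
    have h1 : z₀ + (r / 2 : ℝ) ∈ ball z₀ r := by
      rw [mem_ball, dist_eq_norm, add_sub_cancel_left, Complex.norm_real,
        Real.norm_of_nonneg (by positivity)]
      linarith
    have h2 := hinj (hrN h1).1 (mem_of_mem_nhds hN) (hrN h1).2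
    have h3 : ((r / 2 : ℝ) : ℂ) = 0 := by linear_combination h2
    rw [Complex.ofReal_eq_zero] at h3
    linarith
  have hdne : ∀ᶠ z in 𝓝[≠] z₀, deriv p z ≠ 0 := by
    refine hpan.deriv.eventually_eq_zero_or_eventually_ne_zero.resolve_left fun h => hnc ?_
    obtain ⟨r, hr, hrN⟩ := Metric.mem_nhds_iff.1 (inter_mem hN h)
    filter_upwards [ball_mem_nhds z₀ hr] with z hz
    exact isOpen_ball.is_const_of_deriv_eq_zero (convex_ball z₀ r).isPreconnected
      (hp.mono fun w hw => (hrN hw).1) (fun w hw => (hrN hw).2) hz (mem_ball_self hr)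
  obtain ⟨r, hr, hrN⟩ := Metric.mem_nhds_iff.1
    (inter_mem hN (eventually_nhdsWithin_iff.1 hdne))
  set B := ball z₀ r
  have hBd : DifferentiableOn ℂ p B := hp.mono fun w hw => (hrN hw).1
  have hBi : InjOn p B := hinj.mono fun w hw => (hrN hw).1
  have hz₀ : z₀ ∈ B := mem_ball_self hr
  have hopen : ∀ s ⊆ B, IsOpen s → IsOpen (p '' s) := by
    refine ((hBd.analyticOnNhd isOpen_ball).is_constant_or_isOpen
      (convex_ball z₀ r).isPreconnected).resolve_left ?_
    rintro ⟨c, hc⟩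
    apply hnc
    filter_upwards [ball_mem_nhds z₀ hr] with z hz
    rw [hc z hz, hc z₀ hz₀]
  set q := Function.invFunOn p B
  have hqp : ∀ z ∈ B, q (p z) = z := fun z hz => hBi.leftInvOn_invFunOn hz
  have hpBo : IsOpen (p '' B) := hopen B subset_rfl isOpen_ball
  have hqm : ∀ w ∈ p '' B, q w ∈ B ∧ p (q w) = w := by
    rintro _ ⟨z, hz, rfl⟩
    rw [hqp z hz]
    exact ⟨hz, rfl⟩
  have hqc : ContinuousOn q (p '' B) := by
    rw [_root_.continuousOn_iff']
    intro t ht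
    refine ⟨p '' (t ∩ B), hopen _ inter_subset_right (ht.inter isOpen_ball), ?_⟩
    ext w
    constructor
    · rintro ⟨hw, hwB⟩
      exact ⟨⟨q w, ⟨hw, (hqm w hwB).1⟩, (hqm w hwB).2⟩, hwB⟩
    · rintro ⟨⟨z, hz, rfl⟩, hwB⟩
      exact ⟨by rw [mem_preimage, hqp z hz.2]; exact hz.1, hwB⟩
  have hqd : ∀ w ∈ p '' B, w ≠ p z₀ → DifferentiableAt ℂ q w := by
    intro w hw hne
    have hqw := hqm w hw
    have h1 : HasDerivAt p (deriv p (q w)) (q w) :=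
      ((hBd _ hqw.1).differentiableAt (isOpen_ball.mem_nhds hqw.1)).hasDerivAt
    refine (h1.of_local_left_inverse (hqc.continuousAt (hpBo.mem_nhds hw)) ?_ ?_).differentiableAt
    · refine (hrN hqw.1).2 fun h => hne ?_
      rw [← hqw.2]
      exact congrArg p h
    · filter_upwards [hpBo.mem_nhds hw] with v hv using (hqm v hv).2
  have hpz₀ : p z₀ ∈ p '' B := mem_image_of_mem p hz₀
  have hqan : AnalyticAt ℂ q (p z₀) := by
    refine Complex.analyticAt_of_differentiable_on_punctured_nhds_of_continuousAt ?_
      (hqc.continuousAt (hpBo.mem_nhds hpz₀))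
    rw [eventually_nhdsWithin_iff]
    filter_upwards [hpBo.mem_nhds hpz₀] with w hw hne using hqd w hw hne
  have hcomp : HasDerivAt (fun z => q (p z)) (deriv q (p z₀) * deriv p z₀) z₀ :=
    hqan.differentiableAt.hasDerivAt.comp z₀ hpan.differentiableAt.hasDerivAt
  have hid : HasDerivAt (fun z => q (p z)) 1 z₀ := by
    refine (hasDerivAt_id z₀).congr_of_eventuallyEq ?_
    filter_upwards [ball_mem_nhds z₀ hr] with z hz using hqp z hz
  intro h0
  have := hcomp.unique hid
  rw [h0, mul_zero] at this
  exact zero_ne_one this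

/-- Local injectivity on the unit disc. -/
def LocInj (p : ℂ → ℂ) : Prop := ∀ z ∈ ball (0 : ℂ) 1, ∃ N ∈ 𝓝 z, InjOn p N

lemma LocInj.deriv_ne_zero {p : ℂ → ℂ} (h : LocInj p) (hp : DifferentiableOn ℂ p (ball 0 1))
    {z : ℂ} (hz : z ∈ ball (0 : ℂ) 1) : deriv p z ≠ 0 := by
  obtain ⟨N, hN, hi⟩ := h z hz
  exact deriv_ne_zero_of_injOn (inter_mem hN (isOpen_ball.mem_nhds hz))
    (hp.mono inter_subset_right) (hi.mono inter_subset_left)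

lemma LocInj.isLocallyInjective {p : ℂ → ℂ} (h : LocInj p) :
    IsLocallyInjective fun z : ball (0 : ℂ) 1 => p z := by
  intro z
  obtain ⟨N, hN, hi⟩ := h z z.2
  obtain ⟨W, hWN, hW, hzW⟩ := _root_.mem_nhds_iff.1 hN
  exact ⟨Subtype.val ⁻¹' W, hW.preimage continuous_subtype_val, hzW,
    fun a ha b hb hab => Subtype.ext (hi (hWN ha) (hWN hb) hab)⟩

lemma LocInj.eqOn {X : Type*} [TopologicalSpace X] {p : ℂ → ℂ} (h : LocInj p) {A : Set X}
    (hA : IsPreconnected A) {f g : X → ℂ} (hf : ContinuousOn f A) (hg : ContinuousOn g A)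
    (hfm : MapsTo f A (ball 0 1)) (hgm : MapsTo g A (ball 0 1))
    (he : ∀ a ∈ A, p (f a) = p (g a)) {a : X} (ha : a ∈ A) (hfg : f a = g a) : EqOn f g A := by
  have : PreconnectedSpace A := isPreconnected_iff_preconnectedSpace.1 hA
  have := (T2Space.isSeparatedMap (fun z : ball (0 : ℂ) 1 => p z)).eq_of_comp_eq
    h.isLocallyInjective (A := A) (g₁ := hfm.restrict) (g₂ := hgm.restrict)
    (hf.mapsToRestrict hfm) (hg.mapsToRestrict hgm) (funext fun a => he a a.2) ⟨a, ha⟩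
    (Subtype.ext hfg)
  intro b hb
  exact congrArg Subtype.val (congrFun this ⟨b, hb⟩)

/-- Through every point of the disc over `V` there is a continuous section of `p` over `V`. -/
def HasSections (p : ℂ → ℂ) (V : Set ℂ) : Prop :=
  ∀ z ∈ ball (0 : ℂ) 1, p z ∈ V → ∃ q : ℂ → ℂ, ContinuousOn q V ∧ MapsTo q V (ball 0 1) ∧
    (∀ y ∈ V, p (q y) = y) ∧ q (p z) = z

lemma HasSections.isEvenlyCovered {p : ℂ → ℂ} {V : Set ℂ} (hs : HasSections p V)
    (hp : ContinuousOn p (ball 0 1)) (hi : LocInj p) (hVo : IsOpen V) (hVc : IsPreconnected V)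
    {y₀ : ℂ} (hy₀ : y₀ ∈ V) :
    IsEvenlyCovered (fun z : ball (0 : ℂ) 1 => p z) y₀
      ((fun z : ball (0 : ℂ) 1 => p z) ⁻¹' {y₀}) := by
  set P : ball (0 : ℂ) 1 → ℂ := fun z => p z
  have hP : Continuous P := continuousOn_iff_continuous_domRestrict.1 hp
  choose! q hqc hqm hpq hqz using hs
  have huniq : ∀ z ∈ ball (0 : ℂ) 1, p z ∈ V → ∀ w ∈ ball (0 : ℂ) 1, p w ∈ V →
      q z (p w) = w → EqOn (q z) (q w) V := fun z hz hpz w hw hpw h =>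
    hi.eqOn hVc (hqc z hz hpz) (hqc w hw hpw) (hqm z hz hpz) (hqm w hw hpw)
      (fun y hy => by rw [hpq z hz hpz y hy, hpq w hw hpw y hy]) hpw
      (by rw [h, hqz w hw hpw])
  let I : Type := {z : ℂ // z ∈ ball (0 : ℂ) 1 ∧ p z = y₀}
  let _ : TopologicalSpace I := ⊥
  have : DiscreteTopology I := ⟨rfl⟩
  have hIV : ∀ e : I, p e.1 ∈ V := fun e => by rw [e.2.2]; exact hy₀
  let toI : P ⁻¹' V → I := fun z => ⟨q z.1 y₀, hqm _ z.1.2 z.2 hy₀, hpq _ z.1.2 z.2 _ hy₀⟩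
  have htoI : Continuous toI := by
    rw [continuous_iff_continuousAt]
    intro z
    have hev : ∀ᶠ w in 𝓝 z, q z.1 (p w.1) = w.1 := by
      obtain ⟨N, hN, hNi⟩ := hi z.1 z.1.2
      have h1 : ContinuousAt (fun w : P ⁻¹' V => (w.1 : ℂ)) z := by fun_prop
      have h2 : ContinuousAt (fun w : P ⁻¹' V => q z.1 (p w.1)) z :=
        ContinuousAt.comp (f := fun w : P ⁻¹' V => P w.1) (g := q z.1)
          ((hqc _ z.1.2 z.2).continuousAt (hVo.mem_nhds z.2)) (by fun_prop)
      have hN' : N ∈ 𝓝 (q z.1 (p z.1)) := by rwa [hqz _ z.1.2 z.2]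
      filter_upwards [h1 hN, h2 hN'] with w hw1 hw2
      exact hNi hw2 hw1 (hpq _ z.1.2 z.2 _ w.2)
    refine (continuousAt_const (y := toI z)).congr ?_
    filter_upwards [hev] with w hw
    exact Subtype.ext (huniq _ z.1.2 z.2 _ w.1.2 w.2 hw hy₀)
  have hH : IsEvenlyCovered P y₀ I := by
    refine ⟨inferInstance, V, hy₀, hVo, hVo.preimage hP,
      { toFun := fun z => (⟨P z.1, z.2⟩, toI z)
        invFun := fun y => ⟨⟨q y.2.1 y.1, hqm _ y.2.2.1 (hIV _) y.1.2⟩, by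
          have := hpq _ y.2.2.1 (hIV y.2) y.1 y.1.2
          simp only [P, mem_preimage]
          rw [this]
          exact y.1.2⟩
        left_inv := ?_, right_inv := ?_, continuous_toFun := ?_, continuous_invFun := ?_ },
      fun z => rfl⟩
    · intro z
      apply Subtype.ext; apply Subtype.ext
      have h1 := huniq _ z.1.2 z.2 _ (toI z).2.1 (hIV _) (by rw [(toI z).2.2])
      change q (toI z).1 (p z.1) = z.1
      rw [← h1 z.2, hqz _ z.1.2 z.2]
    · rintro ⟨y, e⟩
      have h0 := hpq _ e.2.1 (hIV e) y y.2
      refine Prod.ext (Subtype.ext h0) (Subtype.ext ?_)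
      have h1 := huniq _ e.2.1 (hIV e) (q e.1 y) (hqm _ e.2.1 (hIV e) y.2) (by rw [h0]; exact y.2)
        (by rw [h0])
      change q (q e.1 y) y₀ = e.1
      rw [← h1 hy₀]
      have := hqz _ e.2.1 (hIV e)
      rwa [e.2.2] at this
    · exact ((hP.comp continuous_subtype_val).subtype_mk _).prodMk htoI
    · refine Continuous.subtype_mk (Continuous.subtype_mk ?_ _) _
      refine continuous_prod_of_discrete_right.2 fun e => ?_
      exact continuousOn_iff_continuous_domRestrict.1 (hqc _ e.2.1 (hIV e))
  exact hH.to_isEvenlyCovered_preimage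

instance : SimplyConnectedSpace (ball (0 : ℂ) 1) := by
  have : ContractibleSpace (ball (0 : ℂ) 1) :=
    (convex_ball (0 : ℂ) 1).contractibleSpace ⟨0, mem_ball_self one_pos⟩
  infer_instance

instance : LocallyPathConnectedSpace (ball (0 : ℂ) 1) := isOpen_ball.locallyPathConnectedSpace

/-- A holomorphic covering map from the unit disc onto (or into) `Ω`. -/
structure DiscCover (p : ℂ → ℂ) (Ω : Set ℂ) : Prop where
  diff : DifferentiableOn ℂ p (ball 0 1)
  inj : LocInj p
  cov : IsCoveringMapOn (fun z : ball (0 : ℂ) 1 => p z) Ω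

lemma LocInj.differentiableOn_lift {p : ℂ → ℂ} (hi : LocInj p)
    (hp : DifferentiableOn ℂ p (ball 0 1)) {A : Set ℂ} (hA : IsOpen A) {f F : ℂ → ℂ}
    (hf : DifferentiableOn ℂ f A)
    (hF : ContinuousOn F A) (hFm : MapsTo F A (ball 0 1))
    (hpF : ∀ z ∈ A, p (F z) = f z) : DifferentiableOn ℂ F A := by
  intro z hz
  have hFz := hFm hz
  have hpan : AnalyticAt ℂ p (F z) := hp.analyticAt (isOpen_ball.mem_nhds hFz)
  have h1 := hpan.hasStrictDerivAt
  have hd := hi.deriv_ne_zero hp hFz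
  have h2 : HasDerivAt (h1.localInverse _ _ _ hd) (deriv p (F z))⁻¹ (f z) := by
    rw [← hpF z hz]
    exact (h1.to_localInverse hd).hasDerivAt
  have h3 : DifferentiableAt ℂ (fun w => h1.localInverse _ _ _ hd (f w)) z :=
    h2.differentiableAt.comp z (hf.differentiableAt (hA.mem_nhds hz))
  refine (h3.congr_of_eventuallyEq ?_).differentiableWithinAt
  have h4 : ∀ᶠ w in 𝓝 z, h1.localInverse _ _ _ hd (p (F w)) = F w :=
    (hF.continuousAt (hA.mem_nhds hz)).eventually (h1.eventually_left_inverse hd)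
  filter_upwards [h4, hA.mem_nhds hz] with w hw hwb
  rw [← hpF w hwb, hw]

lemma DiscCover.exists_lift {p : ℂ → ℂ} {Ω : Set ℂ} (h : DiscCover p Ω) {f : ℂ → ℂ}
    (hf : DifferentiableOn ℂ f (ball 0 1)) (hfΩ : MapsTo f (ball 0 1) Ω) {a e : ℂ}
    (ha : a ∈ ball (0 : ℂ) 1) (he : e ∈ ball (0 : ℂ) 1) (hae : p e = f a) :
    ∃ F : ℂ → ℂ, DifferentiableOn ℂ F (ball 0 1) ∧ MapsTo F (ball 0 1) (ball 0 1) ∧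
      (∀ z ∈ ball (0 : ℂ) 1, p (F z) = f z) ∧ F a = e := by
  obtain ⟨F, ⟨hFa, hF⟩, -⟩ := h.cov.existsUnique_continuousMap_lifts
    ⟨fun z : ball (0 : ℂ) 1 => f z, continuousOn_iff_continuous_domRestrict.1 hf.continuousOn⟩
    (a₀ := ⟨a, ha⟩) (e₀ := ⟨e, he⟩) hae fun z => hfΩ z.2
  classical
  let G : ℂ → ℂ := fun z => if hz : z ∈ ball (0 : ℂ) 1 then (F ⟨z, hz⟩ : ℂ) else z
  have hG : ∀ z : ball (0 : ℂ) 1, G z = F z := fun z => dif_pos z.2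
  have hGc : ContinuousOn G (ball 0 1) := by
    rw [continuousOn_iff_continuous_domRestrict]
    have : (ball (0 : ℂ) 1).domRestrict G = fun z => (F z : ℂ) := funext hG
    rw [this]
    fun_prop
  have hGm : MapsTo G (ball 0 1) (ball 0 1) := fun z hz => by
    rw [hG ⟨z, hz⟩]; exact (F _).2
  have hpG : ∀ z ∈ ball (0 : ℂ) 1, p (G z) = f z := fun z hz => by
    rw [hG ⟨z, hz⟩]; exact congrFun hF ⟨z, hz⟩
  exact ⟨G, h.inj.differentiableOn_lift h.diff isOpen_ball hf hGc hGm hpG, hGm, hpG, by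
    rw [hG ⟨a, ha⟩, hFa]⟩

/-- Locally constant cocycles with values in a group are coboundaries over a simply connected
space. -/
lemma exists_trivialization_cocycle {ι X F : Type*} [TopologicalSpace X] [SimplyConnectedSpace X]
    [LocallyPathConnectedSpace X] [Group F] (W : ι → Set X) (hW : ∀ i, IsOpen (W i))
    (hcov : ∀ x, ∃ i, x ∈ W i) (c : ι → ι → X → F) (hself : ∀ i x, c i i x = 1)
    (hcomp : ∀ i j k, ∀ x ∈ W i ∩ W j ∩ W k, c i j x * c j k x = c i k x)
    (hconst : ∀ i j, ∀ x ∈ W i ∩ W j, ∀ᶠ y in 𝓝 x, c i j y = c i j x) :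
    ∃ lab : ι → X → F, (∀ i, ∀ x ∈ W i, ∀ᶠ y in 𝓝 x, lab i y = lab i x) ∧
      ∀ i j, ∀ x ∈ W i ∩ W j, lab j x = lab i x * c i j x := by
  let _ : TopologicalSpace F := ⊥
  have : DiscreteTopology F := ⟨rfl⟩
  choose ind hind using hcov
  let Z : FiberBundleCore ι X F :=
    { baseSet := W
      isOpen_baseSet := hW
      indexAt := ind
      mem_baseSet_at := hind
      coordChange := fun i j x v => v * c i j x
      coordChange_self := fun i x _ v => by rw [hself, mul_one]
      continuousOn_coordChange := fun i j => by
        rintro ⟨x, v⟩ ⟨hx, -⟩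
        have h1 : ∀ᶠ q in 𝓝 (x, v), q.1 ∈ {y | c i j y = c i j x} ∧ q.2 ∈ ({v} : Set F) :=
          (continuous_fst.tendsto (x, v)).eventually (hconst i j x hx) |>.and
            ((continuous_snd.tendsto (x, v)).eventually (isOpen_discrete _ |>.mem_nhds rfl))
        refine (ContinuousAt.congr (f := fun _ => v * c i j x) continuousAt_const
          ?_).continuousWithinAt
        filter_upwards [h1] with q hq
        rw [hq.1, hq.2]
      coordChange_comp := fun i j k x hx v => by rw [mul_assoc, hcomp i j k x hx] }
  obtain ⟨x₀⟩ : Nonempty X := inferInstance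
  obtain ⟨Φ, ⟨-, hΦ⟩, -⟩ := (FiberBundle.isCoveringMap (F := F)
    (E := Z.Fiber)).existsUnique_continuousMap_lifts (ContinuousMap.id X) x₀ ⟨x₀, (1 : F)⟩ rfl
  have hΦ1 : ∀ x, (Φ x).1 = x := fun x => congrFun hΦ x
  let v : X → F := fun x => (Φ x).2
  have hlab : ∀ i x, (Z.localTriv i (Φ x)).2 = v x * c (ind x) i x := by
    intro i x
    rw [Z.localTriv_apply]
    simp only [hΦ1, Z, v]
  refine ⟨fun i x => (Z.localTriv i (Φ x)).2, fun i x hx => ?_, fun i j x hx => ?_⟩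
  · have h1 : ContinuousAt (fun y => (Z.localTriv i (Φ y)).2) x := by
      refine continuous_snd.continuousAt.comp
        (ContinuousAt.comp (f := Φ) ?_ Φ.continuous.continuousAt)
      refine (Z.localTriv i).continuousOn.continuousAt ((Z.localTriv i).open_source.mem_nhds ?_)
      rw [Z.mem_localTriv_source, hΦ1]
      exact hx
    exact h1 (isOpen_discrete {(Z.localTriv i (Φ x)).2} |>.mem_nhds rfl)
  · simp only [hlab]
    rw [mul_assoc, hcomp _ _ _ x ⟨⟨hind x, hx.1⟩, hx.2⟩]

/-- The type of points of the unit disc. -/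
abbrev Disc : Type := ball (0 : ℂ) 1

/-- `γ` is a deck transformation of `p`. -/
def IsDeck (p : ℂ → ℂ) (γ : Disc ≃ₜ Disc) : Prop := ∀ z, p (γ z) = p z

lemma IsDeck.mul {p : ℂ → ℂ} {γ γ' : Disc ≃ₜ Disc} (h : IsDeck p γ) (h' : IsDeck p γ') :
    IsDeck p (γ * γ') := fun z => (h _).trans (h' z)

lemma IsDeck.inv {p : ℂ → ℂ} {γ : Disc ≃ₜ Disc} (h : IsDeck p γ) : IsDeck p γ⁻¹ := fun z => by
  have := h (γ⁻¹ z)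
  rw [← this]
  exact congrArg (fun w : Disc => p w) (γ.apply_symm_apply z)

lemma LocInj.eq_of_comp_eq {p : ℂ → ℂ} (hi : LocInj p) {X : Type*} [TopologicalSpace X]
    [PreconnectedSpace X] {f g : X → Disc} (hf : Continuous f) (hg : Continuous g)
    (h : ∀ x, p (f x) = p (g x)) {x : X} (hx : f x = g x) : f = g :=
  (T2Space.isSeparatedMap (fun z : Disc => p z)).eq_of_comp_eq hi.isLocallyInjective hf hg
    (funext h) x hx

lemma DiscCover.exists_deck {p : ℂ → ℂ} {Ω : Set ℂ} (h : DiscCover p Ω)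
    (hΩ : MapsTo p (ball 0 1) Ω) {z w : Disc} (hzw : p z = p w) :
    ∃ γ : Disc ≃ₜ Disc, IsDeck p γ ∧ γ z = w := by
  have key : ∀ z w : Disc, p z = p w → ∃ F : C(Disc, Disc), F z = w ∧ ∀ x, p (F x) = p x := by
    intro z w hzw
    obtain ⟨F, ⟨h1, h2⟩, -⟩ := h.cov.existsUnique_continuousMap_lifts
      ⟨fun z : Disc => p z, continuousOn_iff_continuous_domRestrict.1 h.diff.continuousOn⟩
      (a₀ := z) (e₀ := w) hzw.symm fun z => hΩ z.2
    exact ⟨F, h1, congrFun h2⟩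
  obtain ⟨F, hF, hpF⟩ := key z w hzw
  obtain ⟨G, hG, hpG⟩ := key w z hzw.symm
  have h1 : (fun x => G (F x)) = id := h.inj.eq_of_comp_eq (by fun_prop) continuous_id
    (fun x => by rw [hpG, hpF]; rfl) (x := z) (by rw [hF, hG]; rfl)
  have h2 : (fun x => F (G x)) = id := h.inj.eq_of_comp_eq (by fun_prop) continuous_id
    (fun x => by rw [hpF, hpG]; rfl) (x := w) (by rw [hG, hF]; rfl)
  exact ⟨⟨⟨F, G, congrFun h1, congrFun h2⟩, F.continuous, G.continuous⟩, hpF, hF⟩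

/-- The value on the overlap of two charts of the cocycle describing the covering. -/
def slitCocycle {K : Type*} (y : ℂ) (i j : Option K) : FreeGroup K :=
  if y.im < 0 then (i.elim 1 FreeGroup.of)⁻¹ * j.elim 1 FreeGroup.of else 1

/-- The deck group of a covering of a slit domain is free, freely generated by the
passages through the slits. -/
theorem exists_free_deck {K : Type*} {p : ℂ → ℂ} {Ω : Set ℂ} (h : DiscCover p Ω)
    (hΩ : MapsTo p (ball 0 1) Ω) (V : Option K → Set ℂ) (hVo : ∀ i, IsOpen (V i))
    (hVc : ∀ i, IsPreconnected (V i)) (hcover : Ω ⊆ ⋃ i, V i)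
    (hsec : ∀ i, HasSections p (V i)) (hball : ∀ i, V i ⊆ ball 0 1)
    (hup : ∀ i, ball 0 1 ∩ {z | z.im ≠ 0} ⊆ V i) (hdisj : ∀ i j, ∀ z ∈ V i ∩ V j, z.im = 0 → i = j)
    {z₀ : ℂ} (hz₀ : z₀ ∈ ball (0 : ℂ) 1) (hpz₀ : p z₀ ∈ V none) :
    ∃ ρ : FreeGroup K →* (Disc ≃ₜ Disc), (∀ g, IsDeck p (ρ g)) ∧ Function.Injective ρ ∧
      ∀ z w : Disc, p z = p w → ∃ g, ρ g z = w := by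
  have hpc : Continuous fun z : Disc => p z :=
    continuousOn_iff_continuous_domRestrict.1 h.diff.continuousOn
  let up : Set ℂ := ball 0 1 ∩ {z | 0 < z.im}
  let dn : Set ℂ := ball 0 1 ∩ {z | z.im < 0}
  have hupV : ∀ i, up ⊆ V i := fun i z hz => hup i ⟨hz.1, ne_of_gt hz.2⟩
  have hdnV : ∀ i, dn ⊆ V i := fun i z hz => hup i ⟨hz.1, ne_of_lt hz.2⟩
  have hupc : IsPreconnected up :=
    ((convex_ball _ _).inter (convex_halfSpace_im_gt 0)).isPreconnected
  have hdnc : IsPreconnected dn :=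
    ((convex_ball _ _).inter (convex_halfSpace_im_lt 0)).isPreconnected
  let yu : ℂ := Complex.I / 2
  let yd : ℂ := -(Complex.I / 2)
  have hyu : yu ∈ up := by
    constructor
    · simp [yu]; norm_num
    · simp [yu]
  have hyd : yd ∈ dn := by
    constructor
    · simp [yd]; norm_num
    · simp [yd]
  obtain ⟨q₀, -, hq₀m, hq₀p, -⟩ := hsec none z₀ hz₀ hpz₀
  let e : Disc := ⟨q₀ yu, hq₀m (hupV _ hyu)⟩
  have hpe : p e = yu := hq₀p _ (hupV _ hyu)
  choose σ hσc hσm hσp hσe using fun i => hsec i e e.2 (by rw [hpe]; exact hupV i hyu)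
  have hσe' : ∀ i, σ i yu = e := fun i => by rw [← hσe i, hpe]
  have hσup : ∀ i j, EqOn (σ i) (σ j) up := fun i j =>
    h.inj.eqOn hupc ((hσc i).mono (hupV i)) ((hσc j).mono (hupV j))
      ((hσm i).mono_left (hupV i)) ((hσm j).mono_left (hupV j))
      (fun y hy => by rw [hσp i y (hupV i hy), hσp j y (hupV j hy)]) hyu (by rw [hσe', hσe'])
  let s : ∀ i, V i → Disc := fun i y => ⟨σ i y, hσm i y.2⟩
  have hsc : ∀ i, Continuous (s i) := fun i =>
    (continuousOn_iff_continuous_domRestrict.1 (hσc i)).subtype_mk _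
  have hps : ∀ i y, p (s i y) = y := fun i y => hσp i y y.2
  -- Crossing the real axis downwards through the slit `i` and back up through the slit `none`.
  have hδ : ∀ i, ∃ γ : Disc ≃ₜ Disc, IsDeck p γ ∧ γ (s i ⟨yd, hdnV i hyd⟩) =
      s none ⟨yd, hdnV none hyd⟩ := fun i => h.exists_deck hΩ (by rw [hps, hps])
  choose δ hδd hδs using hδ
  have hδdn : ∀ i y (hy : y ∈ dn), δ i (s i ⟨y, hdnV i hy⟩) = s none ⟨y, hdnV none hy⟩ := by
    intro i y hy
    have : PreconnectedSpace dn := isPreconnected_iff_preconnectedSpace.1 hdnc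
    have := h.inj.eq_of_comp_eq (X := dn) (f := fun y => δ i (s i ⟨y, hdnV i y.2⟩))
      (g := fun y => s none ⟨y, hdnV none y.2⟩) ((δ i).continuous.comp ((hsc i).comp (by fun_prop)))
      ((hsc none).comp (by fun_prop)) (fun y => by rw [hδd i, hps, hps]) (x := ⟨yd, hyd⟩) (hδs i)
    exact congrFun this ⟨y, hy⟩
  let ρ : FreeGroup K →* (Disc ≃ₜ Disc) := FreeGroup.lift fun k => δ (Option.some k)
  have hδ0 : δ none = 1 := by
    apply DFunLike.coe_injective
    exact h.inj.eq_of_comp_eq (δ none).continuous continuous_id (hδd none) (hδs none)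
  let gen : Option K → FreeGroup K := fun i => i.elim 1 FreeGroup.of
  have hρgen : ∀ i, ρ (gen i) = δ i := by
    rintro (_ | k)
    · simp [gen, hδ0]
    · simp [gen, ρ]
  have hρd : ∀ g, IsDeck p (ρ g) := by
    intro g
    induction g using FreeGroup.induction_on with
    | C1 => simp only [map_one]; intro z; rfl
    | of k => rw [← show gen (Option.some k) = FreeGroup.of k from rfl, hρgen]; exact hδd _
    | inv_of k _ =>
      rw [← show gen (Option.some k) = FreeGroup.of k from rfl, map_inv, hρgen]; exact (hδd _).inv
    | mul a b ha hb => rw [map_mul]; exact ha.mul hb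
  have hWo : ∀ i, IsOpen ((fun z : Disc => p z) ⁻¹' V i) := fun i => (hVo i).preimage hpc
  obtain ⟨lab₀, hlab₀c, hlab₀⟩ := exists_trivialization_cocycle (X := Disc)
    (fun i => (fun z : Disc => p z) ⁻¹' V i) hWo
    (fun z => by simpa using hcover (hΩ z.2)) (fun i j z => slitCocycle (p z) i j)
    (fun i z => by simp [slitCocycle]) (fun i j k z _ => by
      simp only [slitCocycle]
      split_ifs
      · group
      · rw [one_mul])
    (fun i j z hz => by
      by_cases h0 : (p z).im = 0
      · obtain rfl := hdisj i j _ hz h0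
        simp [slitCocycle]
      · have h1 : Continuous fun z : Disc => (p z).im := Complex.continuous_im.comp hpc
        rcases lt_or_gt_of_ne h0 with h0 | h0
        · filter_upwards [h1.continuousAt.eventually_lt_const h0] with w hw
          simp [slitCocycle, h0, hw]
        · filter_upwards [h1.continuousAt.eventually_const_lt h0] with w hw
          simp [slitCocycle, h0.not_gt, hw.not_gt])
  let lab : Option K → Disc → FreeGroup K := fun i z => (lab₀ none e)⁻¹ * lab₀ i z
  have hlabc : ∀ i (z : Disc), p z ∈ V i → ∀ᶠ w in 𝓝 z, lab i w = lab i z := fun i z hz => by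
    filter_upwards [hlab₀c i z hz] with w hw
    simp only [lab, hw]
  have hlab : ∀ i j (z : Disc), p z ∈ V i → p z ∈ V j →
      lab j z = lab i z * slitCocycle (p z) i j := fun i j z hi hj => by
    simp only [lab, hlab₀ i j z ⟨hi, hj⟩, mul_assoc]
  have hlabe : ∀ i, lab i e = 1 := by
    intro i
    rw [hlab none i e (by rw [hpe]; exact hupV _ hyu) (by rw [hpe]; exact hupV _ hyu), hpe]
    have : ¬ yu.im < 0 := not_lt.2 (le_of_lt hyu.2)
    simp [lab, slitCocycle, this]
  have hlabs : ∀ i y, lab i (s i y) = 1 := by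
    intro i y
    have : PreconnectedSpace (V i) := isPreconnected_iff_preconnectedSpace.1 (hVc i)
    have h1 : IsLocallyConstant fun y => lab i (s i y) := by
      rw [IsLocallyConstant.iff_eventually_eq]
      intro y
      exact (hsc i).continuousAt.eventually (hlabc i (s i y) (by rw [hps]; exact y.2))
    rw [h1.apply_eq_of_preconnectedSpace y ⟨yu, hupV i hyu⟩]
    have h2 : s i ⟨yu, hupV i hyu⟩ = e := Subtype.ext (hσe' i)
    simp only [h2, hlabe]
  -- Deck transformations act on labels by left multiplication.
  have hact : ∀ γ, IsDeck p γ → ∃ c : FreeGroup K, ∀ i (z : Disc), p z ∈ V i →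
      lab i (γ z) = c * lab i z := by
    intro γ hγ
    choose ind hind using fun z : Disc => mem_iUnion.1 (hcover (hΩ z.2))
    have hindep : ∀ i j (z : Disc), p z ∈ V i → p z ∈ V j →
        lab j (γ z) * (lab j z)⁻¹ = lab i (γ z) * (lab i z)⁻¹ := by
      intro i j z hi hj
      rw [hlab i j z hi hj, hlab i j (γ z) (by rwa [hγ]) (by rwa [hγ]), hγ]
      group
    have h1 : IsLocallyConstant fun z => lab (ind z) (γ z) * (lab (ind z) z)⁻¹ := by
      rw [IsLocallyConstant.iff_eventually_eq]
      intro z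
      filter_upwards [hlabc _ z (hind z), γ.continuous.continuousAt.eventually
        (hlabc (ind z) (γ z) (by rw [hγ]; exact hind z)), (hWo (ind z)).mem_nhds (hind z)]
        with w h1 h2 h3
      rw [hindep _ _ w h3 (hind w), h1, h2]
    refine ⟨lab (ind e) (γ e) * (lab (ind e) e)⁻¹, fun i z hz => ?_⟩
    rw [← h1.apply_eq_of_preconnectedSpace z e, hindep i _ z hz (hind z), inv_mul_cancel_right]
  have hactδ : ∀ j i (z : Disc), p z ∈ V i → lab i (δ j z) = gen j * lab i z := by
    intro j
    obtain ⟨c, hc⟩ := hact _ (hδd j)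
    suffices h1 : c = gen j by rw [← h1]; exact hc
    have h2 := hc none (s j ⟨yd, hdnV j hyd⟩) (by rw [hps]; exact hdnV _ hyd)
    have hyd' : yd.im < 0 := hyd.2
    rw [hδs, hlabs, hlab j none _ (by rw [hps]; exact hdnV _ hyd) (by rw [hps]; exact hdnV _ hyd),
      hlabs, hps] at h2
    simp only [slitCocycle, hyd', if_true, one_mul, Option.elim_none, mul_one] at h2
    exact (mul_inv_eq_one.1 h2.symm)
  have hactρ : ∀ g i (z : Disc), p z ∈ V i → lab i (ρ g z) = g * lab i z := by
    intro g
    have hinv : ∀ g, (∀ i (z : Disc), p z ∈ V i → lab i (ρ g z) = g * lab i z) →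
        ∀ i (z : Disc), p z ∈ V i → lab i (ρ g⁻¹ z) = g⁻¹ * lab i z := by
      intro g hg i z hz
      have h1 := hg i (ρ g⁻¹ z) (by rwa [hρd])
      have h2 : ρ g (ρ g⁻¹ z) = z := by
        rw [map_inv]; exact (ρ g).apply_symm_apply z
      rw [h2] at h1
      rw [h1, inv_mul_cancel_left]
    have hof : ∀ k i (z : Disc), p z ∈ V i →
        lab i (ρ (FreeGroup.of k) z) = FreeGroup.of k * lab i z := by
      intro k
      rw [← show gen (Option.some k) = FreeGroup.of k from rfl, hρgen]
      exact hactδ _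
    induction g using FreeGroup.induction_on with
    | C1 => intro i z _; rw [map_one, one_mul]; rfl
    | of k => exact hof k
    | inv_of k _ => exact hinv _ (hof k)
    | mul a b ha hb =>
      intro i z hz
      rw [map_mul, mul_assoc, ← hb i z hz, ← ha i _ (by rwa [hρd])]
      rfl
  -- Every point is determined by its label and its image.
  have horb : ∀ i (z : Disc) (hz : p z ∈ V i), ρ (lab i z) (s i ⟨p z, hz⟩) = z := by
    have hwell : ∀ i j (z : Disc) (hi : p z ∈ V i) (hj : p z ∈ V j),
        ρ (lab j z) (s j ⟨p z, hj⟩) = ρ (lab i z) (s i ⟨p z, hi⟩) := by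
      intro i j z hi hj
      rw [hlab i j z hi hj]
      rcases lt_trichotomy (p z).im 0 with h0 | h0 | h0
      · simp only [slitCocycle, h0, if_true, map_mul, map_inv]
        change ρ (lab i z) ((ρ (gen i))⁻¹ (ρ (gen j) _)) = _
        have hb : p z ∈ dn := ⟨hball i hi, h0⟩
        rw [hρgen, hρgen, hδdn j _ hb, ← hδdn i _ hb]
        exact congrArg _ ((δ i).symm_apply_apply _)
      · obtain rfl := hdisj i j _ ⟨hi, hj⟩ h0
        simp [slitCocycle, h0]
      · simp only [slitCocycle, h0.not_gt, if_false, mul_one]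
        exact congrArg _ (Subtype.ext (hσup j i ⟨hball i hi, h0⟩))
    choose ind hind using fun z : Disc => mem_iUnion.1 (hcover (hΩ z.2))
    have hT : (fun z : Disc => ρ (lab (ind z) z) (s (ind z) ⟨p z, hind z⟩)) = id := by
      refine h.inj.eq_of_comp_eq ?_ continuous_id (fun z => by rw [hρd, hps]; rfl) (x := e) ?_
      · rw [continuous_iff_continuousAt]
        intro z
        have hσ' : ContinuousAt (fun w : (fun z : Disc => p z) ⁻¹' V (ind z) =>
            ρ (lab (ind z) z) (s (ind z) ⟨p w, w.2⟩)) ⟨z, hind z⟩ :=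
          ((ρ _).continuous.comp ((hsc _).comp
            ((hpc.comp continuous_subtype_val).subtype_mk _))).continuousAt
        have hopen := (hWo (ind z)).isOpenEmbedding_subtypeVal
        have h2 := hopen.continuousAt_iff (x := ⟨z, hind z⟩)
          (g := fun z : Disc => ρ (lab (ind z) z) (s (ind z) ⟨p z, hind z⟩))
        refine h2.1 (hσ'.congr ?_)
        have h3 : ∀ᶠ w : (fun z : Disc => p z) ⁻¹' V (ind z) in 𝓝 ⟨z, hind z⟩,
            lab (ind z) w = lab (ind z) z :=
          (hopen.continuous.tendsto ⟨z, hind z⟩).eventually (hlabc _ z (hind z))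
        filter_upwards [h3] with w hw
        simp only [Function.comp_apply]
        rw [hwell (ind z) (ind w) w w.2 (hind w), hw]
      · have : s (ind e) ⟨p e, hind e⟩ = e := Subtype.ext (hσe _)
        simp only [this, hlabe, map_one]
        rfl
    intro i z hz
    rw [hwell (ind z) i z (hind z) hz]
    exact congrFun hT z
  refine ⟨ρ, hρd, fun a b hab => ?_, fun z w hzw => ?_⟩
  · have h1 := hactρ a none e (by rw [hpe]; exact hupV _ hyu)
    have h2 := hactρ b none e (by rw [hpe]; exact hupV _ hyu)
    rw [hlabe, mul_one] at h1 h2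
    rw [← h1, ← h2, hab]
  · obtain ⟨i, hi⟩ := mem_iUnion.1 (hcover (hΩ z.2))
    have hi' : p w ∈ V i := by rwa [← hzw]
    refine ⟨lab i w * (lab i z)⁻¹, ?_⟩
    have h1 := horb i z hi
    have h2 := horb i w hi'
    have h3 : s i ⟨p z, hi⟩ = s i ⟨p w, hi'⟩ := by congr 2
    rw [map_mul, map_inv]
    change ρ (lab i w) ((ρ (lab i z))⁻¹ z) = w
    have h4 : (ρ (lab i z))⁻¹ z = s i ⟨p z, hi⟩ := by
      conv_lhs => rw [← h1]
      rw [horb i z hi]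
      exact (ρ (lab i z)).symm_apply_eq.2 h1.symm
    rw [h4, h3, h2]

lemma hasSqrts_of_isSimplyConnected {V : Set ℂ} (hV : IsSimplyConnected V) (hVo : IsOpen V) :
    HasSqrts V := by
  intro f hf hf0
  obtain ⟨g, hg, hgf⟩ := Complex.exists_continuousOn_pow_eq hV hVo hf.continuousOn
    (by rintro ⟨z, hz, h⟩; exact hf0 z hz h) two_ne_zero
  refine ⟨g, fun z hz => ?_, fun z _ => hgf z⟩
  have hz' := hVo.mem_nhds hz
  have hgz : g z ≠ 0 := fun h => hf0 z hz (by rw [← hgf, h]; simp)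
  have hgc : ContinuousAt g z := hg.continuousAt hz'
  have h2 : g z + g z ≠ 0 := by rw [← two_mul]; exact mul_ne_zero two_ne_zero hgz
  have h1 : Tendsto (fun w => g w + g z) (𝓝[≠] z) (𝓝 (g z + g z)) :=
    ((hgc.add continuousAt_const).tendsto).mono_left nhdsWithin_le_nhds
  have hd := (hf.differentiableAt hz').hasDerivAt
  rw [hasDerivAt_iff_tendsto_slope] at hd
  have h3 := hd.div h1 h2
  have h4 : HasDerivAt g (deriv f z / (g z + g z)) z := by
    rw [hasDerivAt_iff_tendsto_slope]
    refine h3.congr' ?_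
    filter_upwards [h1.eventually_ne h2] with w hw
    rw [Pi.div_apply, div_eq_iff hw, slope_def_field, slope_def_field, ← hgf, ← hgf]
    ring
  exact h4.differentiableAt.differentiableWithinAt

/-- The unit disc cut along the complement of `I` in its real diameter. -/
def slitDisc (I : Set ℝ) : Set ℂ := ball 0 1 ∩ {z | z.im ≠ 0 ∨ z.re ∈ I}

lemma isOpen_slitDisc {I : Set ℝ} (hI : IsOpen I) : IsOpen (slitDisc I) :=
  isOpen_ball.inter ((isOpen_ne_fun Complex.continuous_im continuous_const).union
    (hI.preimage Complex.continuous_re))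

lemma starConvex_slitDisc {I : Set ℝ} (hI : I.OrdConnected) (hI1 : I ⊆ Ioo (-1) 1) {c : ℝ}
    (hc : c ∈ I) : StarConvex ℝ (c : ℂ) (slitDisc I) := by
  have hcb : (c : ℂ) ∈ ball (0 : ℂ) 1 := by
    rw [mem_ball_zero_iff, Complex.norm_real, Real.norm_eq_abs, abs_lt]
    exact hI1 hc
  rintro z ⟨hz, hz'⟩ a b ha hb hab
  refine ⟨convex_ball (0 : ℂ) 1 hcb hz ha hb hab, ?_⟩
  rcases eq_or_lt_of_le hb with rfl | hb0
  · right
    obtain rfl : a = 1 := by linarith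
    simpa using hc
  · rcases hz' with h | h
    · left
      simp only [Complex.add_im, Complex.real_smul, Complex.mul_im, Complex.ofReal_im,
        Complex.ofReal_re, mul_zero, zero_mul, add_zero, zero_add]
      exact mul_ne_zero hb0.ne' h
    · right
      have h1 := hI.convex hc h ha hb hab
      simpa using h1

lemma mem_slitDisc_ofReal {I : Set ℝ} (hI1 : I ⊆ Ioo (-1) 1) {c : ℝ} (hc : c ∈ I) :
    (c : ℂ) ∈ slitDisc I := by
  refine ⟨?_, Or.inr (by simpa using hc)⟩
  rw [mem_ball_zero_iff, Complex.norm_real, Real.norm_eq_abs, abs_lt]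
  exact hI1 hc

lemma isPreconnected_slitDisc {I : Set ℝ} (hI : I.OrdConnected) (hI1 : I ⊆ Ioo (-1) 1)
    (hne : I.Nonempty) : IsPreconnected (slitDisc I) := by
  obtain ⟨c, hc⟩ := hne
  exact ((starConvex_slitDisc hI hI1 hc).isPathConnected
    (mem_slitDisc_ofReal hI1 hc)).isConnected.isPreconnected

lemma hasSqrts_slitDisc {I : Set ℝ} (hI : I.OrdConnected) (hI1 : I ⊆ Ioo (-1) 1)
    (hne : I.Nonempty) (hIo : IsOpen I) : HasSqrts (slitDisc I) := by
  obtain ⟨c, hc⟩ := hne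
  have := (starConvex_slitDisc hI hI1 hc).contractibleSpace ⟨(c : ℂ), mem_slitDisc_ofReal hI1 hc⟩
  refine hasSqrts_of_isSimplyConnected ?_ (isOpen_slitDisc hIo)
  exact inferInstanceAs (SimplyConnectedSpace (slitDisc I))

/-- The Joukowsky map of the unit disc onto the complement of `[m - 2 * h, m + 2 * h]`. -/
def jouk (m h : ℝ) (z : ℂ) : ℂ := m + h * (z + z⁻¹)

lemma jouk_im {m h : ℝ} {z : ℂ} :
    (jouk m h z).im = h * (z.im * (1 - (Complex.normSq z)⁻¹)) := by
  simp only [jouk, Complex.add_im, Complex.mul_im, Complex.ofReal_im, Complex.ofReal_re,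
    Complex.inv_im, zero_mul, add_zero, zero_add]
  ring

lemma jouk_ofReal (m h t : ℝ) : jouk m h t = ((m + h * (t + t⁻¹) : ℝ) : ℂ) := by
  simp [jouk]

lemma jouk_im_ne_zero {m h : ℝ} (hh : 0 < h) {z : ℂ} (hz : z ∈ ball (0 : ℂ) 1)
    (hi : z.im ≠ 0) : (jouk m h z).im ≠ 0 := by
  have hz0 : z ≠ 0 := by rintro rfl; simp at hi
  rw [jouk_im]
  refine mul_ne_zero hh.ne' (mul_ne_zero hi ?_)
  rw [mem_ball_zero_iff] at hz
  have h1 : Complex.normSq z < 1 := by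
    rw [Complex.normSq_eq_norm_sq]
    nlinarith [norm_nonneg z]
  have h2 := (one_lt_inv₀ (Complex.normSq_pos.2 hz0)).2 h1
  linarith

lemma jouk_injOn {m h : ℝ} (hh : 0 < h) : InjOn (jouk m h) (ball 0 1 \ {0}) := by
  rintro z ⟨hz, hz0⟩ w ⟨hw, hw0⟩ hzw
  rw [mem_ball_zero_iff] at hz hw
  rw [mem_singleton_iff] at hz0 hw0
  have hh' : (h : ℂ) ≠ 0 := by exact_mod_cast hh.ne'
  have h1 : z + z⁻¹ = w + w⁻¹ := mul_left_cancel₀ hh' (add_left_cancel hzw)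
  have h2 : (z - w) * (z * w - 1) = 0 := by
    field_simp at h1
    linear_combination h1
  rcases mul_eq_zero.1 h2 with h3 | h3
  · exact sub_eq_zero.1 h3
  · exfalso
    have h4 : ‖z * w‖ = 1 := by rw [sub_eq_zero.1 h3, norm_one]
    rw [norm_mul] at h4
    nlinarith [norm_nonneg z, norm_nonneg w]

lemma exists_jouk_eq {m h : ℝ} (hh : 0 < h) {c : ℂ}
    (hc : ∀ t : ℝ, t ∈ Icc (m - 2 * h) (m + 2 * h) → (t : ℂ) ≠ c) :
    ∃ z ∈ ball (0 : ℂ) 1, z ≠ 0 ∧ jouk m h z = c := by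
  have hh' : (h : ℂ) ≠ 0 := by exact_mod_cast hh.ne'
  obtain ⟨s, hs⟩ := IsAlgClosed.exists_pow_nat_eq (((c - m) / h) ^ 2 - 4) (n := 2) two_pos
  set k := (c - m) / h with hk
  have hck : c = m + h * k := by rw [hk]; field_simp; ring
  set z := (k + s) / 2 with hz
  have hzz : z * (k - z) = 1 := by
    rw [hz]; linear_combination -hs / 4
  have hz0 : z ≠ 0 := by intro h0; rw [h0] at hzz; simp at hzz
  have hzi : z⁻¹ = k - z := (eq_comm.1 (eq_inv_of_mul_eq_one_right hzz)).symm ▸ rfl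
  have hj : jouk m h z = c := by rw [jouk, hzi, hck]; ring
  have hj' : jouk m h z⁻¹ = c := by rw [jouk, inv_inv, hzi, hck]; ring
  rcases lt_trichotomy ‖z‖ 1 with h1 | h1 | h1
  · exact ⟨z, mem_ball_zero_iff.2 h1, hz0, hj⟩
  · exfalso
    have hzc : z⁻¹ = conj z := by
      rw [Complex.inv_def, Complex.normSq_eq_norm_sq, h1]; simp
    have hcr : ((m + h * (2 * z.re) : ℝ) : ℂ) = c := by
      rw [← hj, jouk, hzc, Complex.add_conj]; push_cast; ring
    have hre : |z.re| ≤ 1 := h1 ▸ Complex.abs_re_le_norm z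
    rw [abs_le] at hre
    exact hc _ ⟨by nlinarith, by nlinarith⟩ hcr
  · refine ⟨z⁻¹, ?_, inv_ne_zero hz0, hj'⟩
    rw [mem_ball_zero_iff, norm_inv]
    exact inv_lt_one_of_one_lt₀ h1

lemma exists_slit_intervals {l : ℕ} {α β : Fin (l + 1) → ℝ} (hαβ : ∀ j, α j < β j)
    (hβα : ∀ j k, j < k → β j < α k) {m h : ℝ} (hm : m = (α 0 + β 0) / 2)
    (hh : h = (β 0 - α 0) / 4) :
    ∃ I : Option (Fin l) → Set ℝ, (∀ i, IsOpen (I i)) ∧ (∀ i, (I i).OrdConnected) ∧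
      (∀ i, I i ⊆ Ioo (-1) 1) ∧ (∀ i, (I i).Nonempty) ∧ 0 ∈ I none ∧
      (∀ i j t, t ∈ I i → t ∈ I j → i = j) ∧
      ∀ t ∈ Ioo (-1 : ℝ) 1, (∃ i, t ∈ I i) ↔
        t = 0 ∨ m + h * (t + t⁻¹) ∉ ⋃ j, Icc (α j) (β j) := by
  have hh0 : 0 < h := by rw [hh]; linarith [hαβ 0]
  have hα0 : α 0 = m - 2 * h := by rw [hm, hh]; ring
  have hβ0 : β 0 = m + 2 * h := by rw [hm, hh]; ring
  have hβm : StrictMono β := fun j k hjk => (hβα j k hjk).trans (hαβ k)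
  have hαm : StrictMono α := fun j k hjk => (hαβ j).trans (hβα j k hjk)
  have hlt : ∀ {t c : ℝ}, 0 < t → (c < m + h * (t + t⁻¹) ↔ (c - m) * t < h * (t ^ 2 + 1)) := by
    intro t c ht
    have h1 : h * (t ^ 2 + 1) = h * (t + t⁻¹) * t := by field_simp
    rw [h1, mul_lt_mul_iff_left₀ ht]
    constructor <;> intro <;> linarith
  have hgt : ∀ {t c : ℝ}, 0 < t → (m + h * (t + t⁻¹) < c ↔ h * (t ^ 2 + 1) < (c - m) * t) := by
    intro t c ht
    have h1 : h * (t ^ 2 + 1) = h * (t + t⁻¹) * t := by field_simp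
    rw [h1, mul_lt_mul_iff_left₀ ht]
    constructor <;> intro <;> linarith
  have hanti : ∀ {s t : ℝ}, 0 < s → s ≤ t → t < 1 →
      m + h * (t + t⁻¹) ≤ m + h * (s + s⁻¹) := by
    intro s t hs hst ht
    have ht0 := hs.trans_le hst
    have h1 : t + t⁻¹ ≤ s + s⁻¹ := by
      have h2 : s + s⁻¹ - (t + t⁻¹) = (t - s) * (1 - s * t) / (s * t) := by field_simp; ring
      have h3 : 0 ≤ (t - s) * (1 - s * t) / (s * t) :=
        div_nonneg (mul_nonneg (by linarith) (by nlinarith)) (by positivity)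
      linarith
    nlinarith
  have hpos : ∀ {t : ℝ}, 0 < t → t < 1 → β 0 < m + h * (t + t⁻¹) := by
    intro t h0 h1
    rw [hlt h0, hβ0]
    nlinarith [mul_pos hh0 (pow_pos (sub_pos.2 h1) 2)]
  have hneg : ∀ {t : ℝ}, -1 < t → t < 0 → m + h * (t + t⁻¹) < α 0 := by
    intro t h1 h0
    have h2 := hpos (t := -t) (by linarith) (by linarith)
    rw [inv_neg, hβ0] at h2
    rw [hα0]
    nlinarith
  let I : Option (Fin l) → Set ℝ := fun i => i.elim
    {t | t ∈ Ioo (-1) 1 ∧ (β (Fin.last l) - m) * t < h * (t ^ 2 + 1)}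
    fun k => {t | t ∈ Ioo 0 1 ∧ (β k.castSucc - m) * t < h * (t ^ 2 + 1) ∧
      h * (t ^ 2 + 1) < (α k.succ - m) * t}
  have hlast : m + 2 * h ≤ β (Fin.last l) := hβ0 ▸ hβm.monotone (Fin.zero_le _)
  have hI0 : ∀ {t : ℝ}, t ∈ Ioo (-1) 1 → t ≤ 0 → t ∈ I none := by
    intro t ht ht0
    refine ⟨ht, ?_⟩
    have : (β (Fin.last l) - m) * t ≤ 0 := mul_nonpos_of_nonneg_of_nonpos (by linarith) ht0
    have : 0 < h * (t ^ 2 + 1) := by positivity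
    linarith
  have hIn : ∀ {t : ℝ}, 0 < t → t < 1 → (t ∈ I none ↔ β (Fin.last l) < m + h * (t + t⁻¹)) := by
    intro t h0 h1
    rw [hlt h0]
    exact ⟨fun h => h.2, fun h => ⟨⟨by linarith, h1⟩, h⟩⟩
  have hIs : ∀ {t : ℝ} {k : Fin l}, t ∈ I (Option.some k) ↔ t ∈ Ioo (0 : ℝ) 1 ∧
      β k.castSucc < m + h * (t + t⁻¹) ∧ m + h * (t + t⁻¹) < α k.succ := by
    intro t k
    constructor
    · rintro ⟨h1, h2, h3⟩
      exact ⟨h1, (hlt h1.1).2 h2, (hgt h1.1).2 h3⟩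
    · rintro ⟨h1, h2, h3⟩
      exact ⟨h1, (hlt h1.1).1 h2, (hgt h1.1).1 h3⟩
  have hsub : ∀ i, I i ⊆ Ioo (-1) 1 := by
    rintro (_ | k) t ht
    · exact ht.1
    · exact ⟨by linarith [ht.1.1], ht.1.2⟩
  refine ⟨I, ?_, ?_, hsub, ?_, hI0 (by norm_num) le_rfl, ?_, ?_⟩
  · rintro (_ | k)
    · exact isOpen_Ioo.inter (isOpen_lt (f := fun t : ℝ => (β (Fin.last l) - m) * t)
        (g := fun t : ℝ => h * (t ^ 2 + 1)) (by fun_prop) (by fun_prop))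
    · exact isOpen_Ioo.inter ((isOpen_lt (f := fun t : ℝ => (β k.castSucc - m) * t)
        (g := fun t : ℝ => h * (t ^ 2 + 1)) (by fun_prop) (by fun_prop)).inter
        (isOpen_lt (f := fun t : ℝ => h * (t ^ 2 + 1)) (g := fun t : ℝ => (α k.succ - m) * t)
        (by fun_prop) (by fun_prop)))
  · rintro (_ | k)
    · refine ⟨fun s hs t ht u hu => ?_⟩
      rcases le_or_gt u 0 with h0 | h0
      · exact hI0 ⟨hs.1.1.trans_le hu.1, hu.2.trans_lt ht.1.2⟩ h0
      · rw [hIn h0 (hu.2.trans_lt ht.1.2)]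
        exact ((hIn (h0.trans_le hu.2) ht.1.2).1 ht).trans_le (hanti h0 hu.2 ht.1.2)
    · refine ⟨fun s hs t ht u hu => ?_⟩
      rw [hIs] at hs ht ⊢
      have hu1 := hu.2.trans_lt ht.1.2
      exact ⟨⟨hs.1.1.trans_le hu.1, hu1⟩,
        ht.2.1.trans_le (hanti (hs.1.1.trans_le hu.1) hu.2 ht.1.2),
        (hanti hs.1.1 hu.1 hu1).trans_lt hs.2.2⟩
  · rintro (_ | k)
    · exact ⟨0, hI0 (by norm_num) le_rfl⟩
    · obtain ⟨y, hy1, hy2⟩ := exists_between (hβα k.castSucc k.succ k.castSucc_lt_succ)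
      have hy0 : β 0 < y := (hβm.monotone (Fin.zero_le _)).trans_lt hy1
      obtain ⟨z, hz, hz0, hzy⟩ := exists_jouk_eq (m := m) (c := y) hh0 (by
        rintro t ht h1
        have : t = y := by exact_mod_cast h1
        rw [hβ0] at hy0
        linarith [ht.2])
      have him : z.im = 0 := by
        by_contra hne
        exact jouk_im_ne_zero (m := m) hh0 hz hne (by rw [hzy]; simp)
      have hzr : z = (z.re : ℂ) := Complex.ext rfl (by simpa using him)
      set t := z.re
      rw [hzr, jouk_ofReal] at hzy
      have hty : m + h * (t + t⁻¹) = y := by exact_mod_cast hzy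
      rw [hzr, mem_ball_zero_iff, Complex.norm_real, Real.norm_eq_abs, abs_lt] at hz
      have ht0 : t ≠ 0 := by rintro h0; apply hz0; rw [hzr, h0]; simp
      have htp : 0 < t := by
        by_contra hn
        have := hneg hz.1 (lt_of_le_of_ne (not_lt.1 hn) ht0)
        linarith [hαβ 0]
      exact ⟨t, hIs.2 ⟨⟨htp, hz.2⟩, by rwa [hty], by rwa [hty]⟩⟩
  · have hns : ∀ (k : Fin l) t, t ∈ I none → t ∉ I (Option.some k) := by
      intro k t h1 h2
      have h3 := hIs.1 h2
      have h4 := (hIn h3.1.1 h3.1.2).1 h1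
      have h5 := hαm.monotone (Fin.le_last k.succ)
      linarith [hαβ (Fin.last l), h3.2.2]
    have hss : ∀ (k k' : Fin l) t, k < k' → t ∈ I (Option.some k) → t ∉ I (Option.some k') := by
      intro k k' t hk h1 h2
      have h3 := hIs.1 h1
      have h4 := hIs.1 h2
      have h5 : α k.succ ≤ α k'.castSucc := hαm.monotone (Fin.succ_le_castSucc_iff.2 hk)
      linarith [hαβ k'.castSucc, h3.2.2, h4.2.1]
    rintro (_ | k) (_ | k') t h1 h2
    · rfl
    · exact absurd h2 (hns _ _ h1)
    · exact absurd h1 (hns _ _ h2)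
    · rcases lt_trichotomy k k' with h3 | h3 | h3
      · exact absurd h2 (hss _ _ _ h3 h1)
      · rw [h3]
      · exact absurd h1 (hss _ _ _ h3 h2)
  · intro t ht
    rcases lt_trichotomy t 0 with h0 | h0 | h0
    · refine iff_of_true ⟨none, hI0 ht h0.le⟩ (Or.inr ?_)
      rw [mem_iUnion]
      rintro ⟨j, hj⟩
      exact absurd hj.1 (not_le.2 ((hneg ht.1 h0).trans_le (hαm.monotone (Fin.zero_le j))))
    · exact iff_of_true ⟨none, hI0 ht h0.le⟩ (Or.inl h0)
    · set y := m + h * (t + t⁻¹) with hy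
      simp only [h0.ne', false_or]
      constructor
      · rintro ⟨_ | k, hi⟩ hyj
        · obtain ⟨j, hj⟩ := mem_iUnion.1 hyj
          have h1 := (hIn h0 ht.2).1 hi
          exact absurd hj.2 (not_le.2 ((hβm.monotone (Fin.le_last j)).trans_lt h1))
        · obtain ⟨j, hj⟩ := mem_iUnion.1 hyj
          obtain ⟨-, h1, h2⟩ := hIs.1 hi
          rcases le_or_gt j k.castSucc with h3 | h3
          · exact absurd hj.2 (not_le.2 ((hβm.monotone h3).trans_lt h1))
          · exact absurd hj.1 (not_le.2
              (h2.trans_le (hαm.monotone (Fin.castSucc_lt_iff_succ_le.1 h3))))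
      · intro hyj
        by_contra! hcon
        have h1 : ∀ k : Fin (l + 1), β k < y := by
          intro k
          induction k using Fin.induction with
          | zero => exact hpos h0 ht.2
          | succ k ih =>
            by_contra! h2
            refine hcon (Option.some k) (hIs.2 ⟨⟨h0, ht.2⟩, ih, ?_⟩)
            by_contra! h3
            exact hyj (mem_iUnion.2 ⟨_, h3, h2⟩)
        exact hcon none ((hIn h0 ht.2).2 (h1 _))

lemma exists_injOn_nhds {p : ℂ → ℂ} {z : ℂ} (hp : AnalyticAt ℂ p z) (hd : deriv p z ≠ 0) :
    ∃ N ∈ 𝓝 z, InjOn p N := by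
  refine ⟨_, hp.hasStrictDerivAt.eventually_left_inverse hd, fun a ha b hb hab => ?_⟩
  rw [← show _ = a from ha, ← show _ = b from hb, hab]

section
variable {ι : Type*} {V : ι → Set ℂ} {Ω : Set ℂ} {p : ℂ → ℂ}

lemma SectionCover.deriv_ne_zero (hc : SectionCover V Ω (ball 0 1) p) (hVo : ∀ i, IsOpen (V i))
    (hcover : Ω ⊆ ⋃ i, V i) {z : ℂ} (hz : z ∈ ball (0 : ℂ) 1) : deriv p z ≠ 0 := by
  obtain ⟨i, hi⟩ := mem_iUnion.1 (hcover (hc.maps hz))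
  obtain ⟨q, hq, -, hpq, hqz⟩ := hc.sec i z hz hi
  have hqd := (hq.differentiableAt ((hVo i).mem_nhds hi)).hasDerivAt
  have hpd := (hc.diff.differentiableAt (isOpen_ball.mem_nhds hz)).hasDerivAt
  rw [← hqz] at hpd
  have h1 := hpd.comp (p z) hqd
  have h2 : HasDerivAt (p ∘ q) 1 (p z) :=
    (hasDerivAt_id (p z)).congr_of_eventuallyEq (by
      filter_upwards [(hVo i).mem_nhds hi] with y hy using hpq y hy)
  have h3 := h1.unique h2
  rw [hqz] at h3
  exact left_ne_zero_of_mul_eq_one h3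

lemma SectionCover.locInj (hc : SectionCover V Ω (ball 0 1) p) (hVo : ∀ i, IsOpen (V i))
    (hcover : Ω ⊆ ⋃ i, V i) : LocInj p := fun _ hz =>
  exists_injOn_nhds (hc.diff.analyticAt (isOpen_ball.mem_nhds hz)) (hc.deriv_ne_zero hVo hcover hz)

lemma SectionCover.hasSections (hc : SectionCover V Ω (ball 0 1) p) (i : ι) :
    HasSections p (V i) := fun z hz hi => by
  obtain ⟨q, hq, h⟩ := hc.sec i z hz hi
  exact ⟨q, hq.continuousOn, h⟩

lemma SectionCover.discCover (hc : SectionCover V Ω (ball 0 1) p) (hVo : ∀ i, IsOpen (V i))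
    (hVc : ∀ i, IsPreconnected (V i)) (hcover : Ω ⊆ ⋃ i, V i) : DiscCover p Ω where
  diff := hc.diff
  inj := hc.locInj hVo hcover
  cov := fun y hy => by
    obtain ⟨i, hi⟩ := mem_iUnion.1 (hcover hy)
    exact (hc.hasSections i).isEvenlyCovered hc.diff.continuousOn (hc.locInj hVo hcover)
      (hVo i) (hVc i) hi

lemma SectionCover.comp_rotation (hc : SectionCover V Ω (ball 0 1) p) {u : ℂ} (hu : ‖u‖ = 1) :
    SectionCover V Ω (ball 0 1) fun z => p (u * z) := by
  have hu0 : u ≠ 0 := by rintro rfl; simp at hu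
  have hm : ∀ v : ℂ, ‖v‖ = 1 → MapsTo (fun z => v * z) (ball (0 : ℂ) 1) (ball 0 1) := by
    intro v hv z hz
    rw [mem_ball_zero_iff] at hz ⊢
    rwa [norm_mul, hv, one_mul]
  refine ⟨hc.diff.comp (by fun_prop) (hm u hu), hc.maps.comp (hm u hu), fun i z hz hi => ?_⟩
  obtain ⟨q, hq, hqm, hpq, hqz⟩ := hc.sec i (u * z) (hm u hu hz) hi
  refine ⟨fun y => u⁻¹ * q y, hq.const_mul _, fun y hy => hm _ (by simp [hu]) (hqm hy),
    fun y hy => ?_, ?_⟩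
  · simp only [mul_inv_cancel_left₀ hu0, hpq y hy]
  · simp only [hqz, inv_mul_cancel_left₀ hu0]

end

/-- The preimage of the complement of `e` in the Riemann sphere under the Joukowsky map. -/
def gapDomain (m h : ℝ) (e : Set ℝ) : Set ℂ :=
  {z | z ∈ ball (0 : ℂ) 1 ∧ (z = 0 ∨ jouk m h z ∉ Complex.ofReal '' e)}

lemma gapDomain_eq_iUnion {ι : Type*} [Nonempty ι] {m h : ℝ} {e : Set ℝ} (hh : 0 < h)
    {I : ι → Set ℝ} (hI : ∀ t ∈ Ioo (-1 : ℝ) 1, (∃ i, t ∈ I i) ↔ t = 0 ∨ m + h * (t + t⁻¹) ∉ e) :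
    gapDomain m h e = ⋃ i, slitDisc (I i) := by
  ext z
  rw [mem_iUnion]
  by_cases hi : z.im = 0
  · have hzr : z = (z.re : ℂ) := Complex.ext rfl (by simpa using hi)
    set t := z.re
    have h1 : z ∈ ball (0 : ℂ) 1 ↔ t ∈ Ioo (-1 : ℝ) 1 := by
      rw [hzr, mem_ball_zero_iff, Complex.norm_real, Real.norm_eq_abs, abs_lt, mem_Ioo]
    have h2 : jouk m h z ∉ Complex.ofReal '' e ↔ m + h * (t + t⁻¹) ∉ e := by
      rw [hzr, jouk_ofReal, mem_image]
      simp only [Complex.ofReal_inj, exists_eq_right]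
    have h3 : z = 0 ↔ t = 0 := by rw [hzr, Complex.ofReal_eq_zero]
    have h4 : ∀ i, z ∈ slitDisc (I i) ↔ z ∈ ball (0 : ℂ) 1 ∧ t ∈ I i := fun i =>
      and_congr_right fun _ => by
        simp [hi, t]
    simp only [h4, exists_and_left, gapDomain, mem_ofPred_eq, h1, h2, h3]
    exact and_congr_right fun ht => (hI t ht).symm
  · constructor
    · rintro ⟨hz, -⟩
      obtain ⟨i⟩ := ‹Nonempty ι›
      exact ⟨i, hz, Or.inl hi⟩
    · rintro ⟨i, hz, -⟩
      refine ⟨hz, Or.inr ?_⟩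
      rintro ⟨t, -, ht⟩
      exact jouk_im_ne_zero hh hz hi (by rw [← ht]; simp)

/-- A normalized universal covering of a gap domain, with its free deck group. -/
theorem exists_gapDomain_cover {l : ℕ} {α β : Fin (l + 1) → ℝ} (hαβ : ∀ j, α j < β j)
    (hβα : ∀ j k, j < k → β j < α k) {m h : ℝ} (hm : m = (α 0 + β 0) / 2)
    (hh : h = (β 0 - α 0) / 4) {e : Set ℝ} (he : e = ⋃ j, Icc (α j) (β j)) :
    ∃ p : ℂ → ℂ, DiscCover p (gapDomain m h e) ∧ p '' ball 0 1 = gapDomain m h e ∧ p 0 = 0 ∧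
      (∃ d : ℝ, 0 < d ∧ HasDerivAt p d 0) ∧ ∃ ρ : FreeGroup (Fin l) →* (Disc ≃ₜ Disc),
        (∀ g, IsDeck p (ρ g)) ∧ Function.Injective ρ ∧
        ∀ z w : Disc, p z = p w → ∃ g, ρ g z = w := by
  have hh0 : 0 < h := by rw [hh]; linarith [hαβ 0]
  obtain ⟨I, hIo, hIc, hI1, hIn, hI0, hId, hI⟩ := exists_slit_intervals hαβ hβα hm hh
  rw [← he] at hI
  have hΩ := gapDomain_eq_iUnion hh0 hI
  set Ω := gapDomain m h e
  set V : Option (Fin l) → Set ℂ := fun i => slitDisc (I i)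
  have hVo : ∀ i, IsOpen (V i) := fun i => isOpen_slitDisc (hIo i)
  have hVc : ∀ i, IsPreconnected (V i) := fun i => isPreconnected_slitDisc (hIc i) (hI1 i) (hIn i)
  have hVΩ : ∀ i, V i ⊆ Ω := fun i => hΩ ▸ subset_iUnion V i
  have h0V : (0 : ℂ) ∈ V none := by
    have := mem_slitDisc_ofReal (hI1 none) hI0
    rwa [Complex.ofReal_zero] at this
  have h0b : (0 : ℂ) ∈ ball (0 : ℂ) 1 := mem_ball_self one_pos
  obtain ⟨p₀, hp₀, hp₀0⟩ := exists_sectionCover_ball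
    (fun i => hasSqrts_slitDisc (hIc i) (hI1 i) (hIn i) (hIo i)) hVo hVc
    (hΩ ▸ isOpen_iUnion hVo) (hVΩ none h0V) (fun z hz => hz.1) hVΩ
  have hd₀ := hp₀.deriv_ne_zero hVo hΩ.le h0b
  have hn₀ : ‖deriv p₀ 0‖ ≠ 0 := norm_ne_zero_iff.2 hd₀
  have hnc : (‖deriv p₀ 0‖ : ℂ) ≠ 0 := by exact_mod_cast hn₀
  let u : ℂ := conj (deriv p₀ 0) / ‖deriv p₀ 0‖
  have hu : ‖u‖ = 1 := by
    simp only [u, norm_div, RCLike.norm_conj, Complex.norm_real, norm_norm]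
    exact div_self hn₀
  let p : ℂ → ℂ := fun z => p₀ (u * z)
  have hp : SectionCover V Ω (ball 0 1) p := hp₀.comp_rotation hu
  have hdc := hp.discCover hVo hVc hΩ.le
  have hp0 : p 0 = 0 := by simp only [p, mul_zero, hp₀0]
  have hpd : HasDerivAt p (‖deriv p₀ 0‖ : ℝ) 0 := by
    have h1 : HasDerivAt p₀ (deriv p₀ 0) (u * 0) := by
      rw [mul_zero]
      exact (hp₀.diff.differentiableAt (isOpen_ball.mem_nhds h0b)).hasDerivAt
    have h2 := h1.comp (0 : ℂ) ((hasDerivAt_id (0 : ℂ)).const_mul u)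
    have h3 : ((‖deriv p₀ 0‖ : ℝ) : ℂ) = deriv p₀ 0 * (u * 1) := by
      simp only [u]
      rw [mul_one, mul_div_assoc', Complex.mul_conj, Complex.normSq_eq_norm_sq, Complex.ofReal_pow]
      field_simp
    rw [h3]
    exact h2
  have hup : ∀ i, ball 0 1 ∩ {z | z.im ≠ 0} ⊆ V i := fun i z hz => ⟨hz.1, Or.inl hz.2⟩
  have hyb : Complex.I / 2 ∈ ball (0 : ℂ) 1 ∩ {z | z.im ≠ 0} := by
    constructor
    · simp; norm_num
    · change (Complex.I / 2).im ≠ 0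
      simp
  refine ⟨p, hdc, Subset.antisymm (image_subset_iff.2 hp.maps) ?_, hp0,
    ⟨_, norm_pos_iff.2 hd₀, hpd⟩,
    exists_free_deck hdc hp.maps V hVo hVc hΩ.le hp.hasSections (fun i z hz => hz.1) hup
      (fun i j z hz hi => ?_) h0b (by rwa [hp0])⟩
  · obtain ⟨q, -, hqm, hpq, -⟩ := hp.hasSections none 0 h0b (by rwa [hp0])
    have hqy := hpq _ (hup none hyb)
    intro y hy
    rw [hΩ] at hy
    obtain ⟨i, hi⟩ := mem_iUnion.1 hy
    obtain ⟨q', -, hqm', hpq', -⟩ := hp.hasSections i _ (hqm (hup none hyb))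
      (by rw [hqy]; exact hup i hyb)
    exact ⟨q' y, hqm' hi, hpq' y hi⟩
  · exact hId i j z.re (hz.1.2.resolve_left (not_not.2 hi)) (hz.2.2.resolve_left (not_not.2 hi))

lemma exists_local_section {p : ℂ → ℂ} {z : ℂ} (hp : AnalyticAt ℂ p z) (hd : deriv p z ≠ 0) :
    ∃ q : ℂ → ℂ, q (p z) = z ∧ DifferentiableAt ℂ q (p z) ∧
      ∀ᶠ y in 𝓝 (p z), p (q y) = y ∧ ContinuousAt q y := by
  have hs := hp.hasStrictDerivAt
  let e := (hs.hasStrictFDerivAt_equiv hd).toOpenPartialHomeomorph p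
  have hez : p z ∈ e.target :=
    (hs.hasStrictFDerivAt_equiv hd).image_mem_toOpenPartialHomeomorph_target
  refine ⟨hs.localInverse _ _ _ hd, (hs.eventually_left_inverse hd).self_of_nhds,
    (hs.to_localInverse hd).hasDerivAt.differentiableAt, ?_⟩
  filter_upwards [hs.eventually_right_inverse hd, e.open_target.mem_nhds hez] with y h1 h2
  exact ⟨h1, e.continuousAt_symm h2⟩

open Classical in
/-- The Joukowsky map as a map into the Riemann sphere. -/
def joukHat (m h : ℝ) (z : ℂ) : OnePoint ℂ := if z = 0 then ∞ else (jouk m h z : ℂ)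

lemma joukHat_zero {m h : ℝ} : joukHat m h 0 = ∞ := if_pos rfl

lemma joukHat_of_ne {m h : ℝ} {z : ℂ} (hz : z ≠ 0) : joukHat m h z = (jouk m h z : ℂ) := if_neg hz

lemma joukHat_injOn {m h : ℝ} (hh : 0 < h) : InjOn (joukHat m h) (ball 0 1) := by
  intro z hz w hw hzw
  by_cases hz0 : z = 0 <;> by_cases hw0 : w = 0
  · rw [hz0, hw0]
  · rw [hz0, joukHat_zero, joukHat_of_ne hw0] at hzw
    exact absurd hzw (infty_ne_coe _)
  · rw [hw0, joukHat_zero, joukHat_of_ne hz0] at hzw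
    exact absurd hzw.symm (infty_ne_coe _)
  · rw [joukHat_of_ne hz0, joukHat_of_ne hw0] at hzw
    exact jouk_injOn hh ⟨hz, hz0⟩ ⟨hw, hw0⟩ (coe_injective hzw)

lemma image_joukHat {m h : ℝ} (hh : 0 < h) {e : Set ℝ} (he : Icc (m - 2 * h) (m + 2 * h) ⊆ e) :
    joukHat m h '' gapDomain m h e =
      insert ∞ ((fun c : ℂ => (c : OnePoint ℂ)) '' (Complex.ofReal '' e)ᶜ) := by
  ext y
  constructor
  · rintro ⟨z, ⟨-, hz⟩, rfl⟩
    by_cases hz0 : z = 0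
    · rw [hz0, joukHat_zero]; exact Or.inl rfl
    · rw [joukHat_of_ne hz0]
      exact Or.inr ⟨_, hz.resolve_left hz0, rfl⟩
  · rintro (rfl | ⟨c, hc, rfl⟩)
    · exact ⟨0, ⟨mem_ball_self one_pos, Or.inl rfl⟩, joukHat_zero⟩
    · obtain ⟨z, hz, hz0, hzc⟩ := exists_jouk_eq hh (m := m) (c := c)
        fun t ht htc => hc ⟨t, he ht, htc⟩
      exact ⟨z, ⟨hz, Or.inr (by rwa [hzc])⟩, by rw [joukHat_of_ne hz0, hzc]⟩

/-- The numerator of the Joukowsky map. -/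
def joukNum (m h : ℝ) (z : ℂ) : ℂ := m * z + h * (z ^ 2 + 1)

lemma jouk_eq_div {m h : ℝ} {z : ℂ} (hz : z ≠ 0) : jouk m h z = joukNum m h z / z := by
  rw [jouk, joukNum]
  field_simp

lemma differentiable_joukNum {m h : ℝ} : Differentiable ℂ (joukNum m h) := by
  unfold joukNum; fun_prop

lemma joukNum_zero {m h : ℝ} : joukNum m h 0 = h := by simp [joukNum]

lemma eventually_joukNum_ne {m h : ℝ} (hh : 0 < h) : ∀ᶠ z in 𝓝 (0 : ℂ), joukNum m h z ≠ 0 :=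
  differentiable_joukNum.continuous.continuousAt.eventually_ne (by
    rw [joukNum_zero]; exact_mod_cast hh.ne')

lemma analyticAt_jouk {m h : ℝ} {z : ℂ} (hz : z ≠ 0) : AnalyticAt ℂ (jouk m h) z := by
  unfold jouk
  exact analyticAt_const.add (analyticAt_const.mul (analyticAt_id.add (analyticAt_inv hz)))

lemma analyticAt_div_joukNum {m h : ℝ} (hh : 0 < h) :
    AnalyticAt ℂ (fun z => z / joukNum m h z) 0 :=
  analyticAt_id.div (differentiable_joukNum.analyticAt 0)
    (eventually_joukNum_ne hh).self_of_nhds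

lemma meroSphereAt_joukHat_comp {m h : ℝ} (hh : 0 < h) {p : ℂ → ℂ} {z : ℂ}
    (hp : AnalyticAt ℂ p z) : MeroSphereAt (fun w => joukHat m h (p w)) z := by
  by_cases hz : p z = 0
  · refine Or.inr ⟨by simp only [hz, joukHat_zero], fun w => p w / joukNum m h (p w), ?_, ?_, ?_⟩
    · have h1 := analyticAt_div_joukNum (m := m) hh
      rw [← hz] at h1
      exact h1.comp hp
    · simp only [hz, zero_div]
    · have h0 : ∀ᶠ y in 𝓝 (p z), joukNum m h y ≠ 0 := by rw [hz]; exact eventually_joukNum_ne hh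
      have h1 : ∀ᶠ w in 𝓝 z, joukNum m h (p w) ≠ 0 := hp.continuousAt.eventually h0
      filter_upwards [h1] with w hw
      by_cases hw0 : p w = 0
      · rw [if_pos (by rw [hw0, zero_div]), hw0, joukHat_zero]
      · rw [if_neg (div_ne_zero hw0 hw), inv_div, joukHat_of_ne hw0, jouk_eq_div hw0]
  · refine Or.inl ⟨?_, fun w => jouk m h (p w), (analyticAt_jouk hz).comp hp, ?_⟩
    · simp only [joukHat_of_ne hz]
      exact (infty_ne_coe _).symm
    · filter_upwards [hp.continuousAt.eventually_ne hz] with w hw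
      exact joukHat_of_ne hw

lemma tendsto_mul_joukHat {m h : ℝ} {p : ℂ → ℂ} {d : ℂ} (hp : HasDerivAt p d 0) (hp0 : p 0 = 0)
    (hd : d ≠ 0) :
    Tendsto (fun z => z * opToC (joukHat m h (p z))) (𝓝[≠] 0) (𝓝 (h / d)) := by
  have h1 : Tendsto (fun z => p z / z) (𝓝[≠] 0) (𝓝 d) := by
    refine hp.tendsto_slope.congr fun z => ?_
    rw [slope_def_field, hp0, sub_zero, sub_zero]
  have h2 : Tendsto p (𝓝[≠] 0) (𝓝 0) :=
    (hp0 ▸ hp.continuousAt.tendsto).mono_left nhdsWithin_le_nhds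
  have h3 : Tendsto (fun z : ℂ => z) (𝓝[≠] 0) (𝓝 0) := nhdsWithin_le_nhds
  have h4 : Tendsto (fun z => m * z + h * (z * p z + (p z / z)⁻¹)) (𝓝[≠] 0)
      (𝓝 (m * 0 + h * (0 * 0 + d⁻¹))) :=
    (h3.const_mul _).add (((h3.mul h2).add (h1.inv₀ hd)).const_mul _)
  have h5 : (m : ℂ) * 0 + h * (0 * 0 + d⁻¹) = h / d := by ring
  rw [h5] at h4
  refine h4.congr' ?_
  filter_upwards [hp.eventually_ne hd (c := 0), self_mem_nhdsWithin] with z hz hz0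
  have hz0' : z ≠ 0 := hz0
  rw [joukHat_of_ne hz]
  change _ = z * jouk m h (p z)
  rw [jouk]
  field_simp

/-- Sphere-valued meromorphic maps lift through the Joukowsky map. -/
lemma exists_joukHat_lift {m h : ℝ} (hh : 0 < h) {x : ℂ → OnePoint ℂ} {z ζ : ℂ}
    (hx : MeroSphereAt x z) (hζ : ζ ∈ ball (0 : ℂ) 1) (hxζ : x z = joukHat m h ζ) :
    ∃ F : ℂ → ℂ, DifferentiableAt ℂ F z ∧ F z = ζ ∧ ∀ᶠ w in 𝓝 z, joukHat m h (F w) = x w := by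
  rcases hx with ⟨hxz, g, hg, hgx⟩ | ⟨hxz, g, hg, hg0, hgx⟩
  · have hζ0 : ζ ≠ 0 := by rintro rfl; exact hxz (by rw [hxζ, joukHat_zero])
    have hgz : g z = jouk m h ζ := by
      rw [hgx.self_of_nhds, joukHat_of_ne hζ0] at hxζ
      exact coe_injective hxζ
    have hd : deriv (jouk m h) ζ ≠ 0 := by
      refine deriv_ne_zero_of_injOn ((isOpen_ball.sdiff isClosed_singleton).mem_nhds ⟨hζ, hζ0⟩)
        (fun w hw => ?_) (jouk_injOn hh)
      exact (analyticAt_jouk hw.2).differentiableAt.differentiableWithinAt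
    obtain ⟨q, hqζ, hqd, hq⟩ := exists_local_section (analyticAt_jouk hζ0) hd
    rw [← hgz] at hqζ hqd hq
    have hF : DifferentiableAt ℂ (fun w => q (g w)) z := hqd.comp z hg.differentiableAt
    refine ⟨fun w => q (g w), hF, hqζ, ?_⟩
    filter_upwards [hgx, hg.continuousAt.eventually hq,
      hF.continuousAt.eventually_ne (by rwa [hqζ])] with w h1 h2 h3
    rw [joukHat_of_ne h3, h1, h2.1]
  · have hζ0 : ζ = 0 := by
      by_contra hne
      rw [hxz, joukHat_of_ne hne] at hxζ
      exact infty_ne_coe _ hxζ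
    subst hζ0
    let G : ℂ → ℂ := fun ζ => ζ / joukNum m h ζ
    have hG0 : G 0 = 0 := zero_div _
    have hd : deriv G 0 ≠ 0 := by
      have h1 := (hasDerivAt_id (0 : ℂ)).fun_div
        (differentiable_joukNum (m := m) (h := h) 0).hasDerivAt
        (eventually_joukNum_ne hh).self_of_nhds
      have hh' : (h : ℂ) ≠ 0 := by exact_mod_cast hh.ne'
      rw [show deriv G 0 = _ from h1.deriv, joukNum_zero]
      simp [hh']
    obtain ⟨q, hq0, hqd, hq⟩ := exists_local_section (analyticAt_div_joukNum (m := m) hh) hd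
    change q (G 0) = 0 at hq0
    change DifferentiableAt ℂ q (G 0) at hqd
    change ∀ᶠ y in 𝓝 (G 0), G (q y) = y ∧ ContinuousAt q y at hq
    rw [hG0] at hq0 hqd hq
    rw [← hg0] at hqd hq
    have hFz : q (g z) = 0 := by rw [hg0, hq0]
    have hF : DifferentiableAt ℂ (fun w => q (g w)) z := hqd.comp z hg.differentiableAt
    refine ⟨fun w => q (g w), hF, hFz, ?_⟩
    have h0 : ∀ᶠ y in 𝓝 (q (g z)), joukNum m h y ≠ 0 := by
      rw [hFz]; exact eventually_joukNum_ne hh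
    have h4 : ∀ᶠ w in 𝓝 z, joukNum m h (q (g w)) ≠ 0 := hF.continuousAt.eventually h0
    filter_upwards [hgx, hg.continuousAt.eventually hq, h4] with w h1 h2 h3
    have h5 : q (g w) / joukNum m h (q (g w)) = g w := h2.1
    rw [h1]
    by_cases h6 : q (g w) = 0
    · rw [h6, joukHat_zero, if_pos]
      rw [← h5, h6, zero_div]
    · rw [joukHat_of_ne h6, jouk_eq_div h6, if_neg, ← h5, inv_div]
      · rw [h5]
      · rw [← h5]; exact div_ne_zero h6 h3

/-- A locally injective holomorphic function whose fibres are orbits of automorphisms of the disc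
is a covering map onto its image. -/
lemma discCover_of_isDiscAut {p : ℂ → ℂ} (hp : DifferentiableOn ℂ p (ball 0 1)) (hi : LocInj p)
    (hγ : ∀ z ∈ ball (0 : ℂ) 1, ∀ w ∈ ball (0 : ℂ) 1, p z = p w →
      ∃ γ, IsDiscAut γ ∧ γ z = w ∧ ∀ ζ ∈ ball (0 : ℂ) 1, p (γ ζ) = p ζ) :
    DiscCover p (p '' ball 0 1) := by
  refine ⟨hp, hi, ?_⟩
  rintro _ ⟨z₀, hz₀, rfl⟩
  obtain ⟨q, hqz, hqd, hq⟩ := exists_local_section (hp.analyticAt (isOpen_ball.mem_nhds hz₀))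
    (hi.deriv_ne_zero hp hz₀)
  have hqb : ∀ᶠ y in 𝓝 (p z₀), q y ∈ ball (0 : ℂ) 1 :=
    hqd.continuousAt.eventually_mem (isOpen_ball.mem_nhds (by rwa [hqz]))
  obtain ⟨r, hr, hrq⟩ := Metric.eventually_nhds_iff_ball.1 (hq.and hqb)
  have hs : HasSections p (ball (p z₀) r) := by
    intro z hz hpz
    obtain ⟨⟨h1, -⟩, h2⟩ := hrq _ hpz
    obtain ⟨γ, hγa, hγz, hγp⟩ := hγ _ h2 z hz h1
    refine ⟨fun y => γ (q y), ?_, fun y hy => hγa.2.mapsTo (hrq y hy).2, fun y hy => ?_, hγz⟩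
    · exact hγa.1.continuousOn.comp
        (fun y hy => (hrq y hy).1.2.continuousWithinAt) fun y hy => (hrq y hy).2
    · rw [hγp _ (hrq y hy).2, (hrq y hy).1.1]
  exact hs.isEvenlyCovered hp.continuousOn hi isOpen_ball
    (convex_ball _ _).isPreconnected (mem_ball_self hr)

/-- Every covering map of the complement of `e` factors through the Joukowsky map. -/
lemma exists_joukHat_factor {l : ℕ} {e : Set ℝ} {x : ℂ → OnePoint ℂ} (hx : IsFGCoveringMap l e x)
    {m h : ℝ} (hh : 0 < h) (he : Icc (m - 2 * h) (m + 2 * h) ⊆ e) :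
    ∃ p : ℂ → ℂ, DiscCover p (gapDomain m h e) ∧ p '' ball 0 1 = gapDomain m h e ∧ p 0 = 0 ∧
      (∃ d : ℝ, 0 < d ∧ HasDerivAt p d 0) ∧ ∀ z ∈ ball (0 : ℂ) 1, joukHat m h (p z) = x z := by
  obtain ⟨hmer, him, hinj, hx0, ⟨c, hc, hlim⟩, ρ, hρa, -, -, -, hρ⟩ := hx
  rw [← image_joukHat hh he] at him
  have h0 : (0 : ℂ) ∈ ball (0 : ℂ) 1 := mem_ball_self one_pos
  have hΩ : gapDomain m h e ⊆ ball 0 1 := fun z hz => hz.1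
  have hex : ∀ z ∈ ball (0 : ℂ) 1, ∃ ζ ∈ gapDomain m h e, joukHat m h ζ = x z := fun z hz => by
    have h1 : x z ∈ x '' ball 0 1 := mem_image_of_mem x hz
    rwa [him] at h1
  choose! p hpΩ hpx using hex
  have hpb : MapsTo p (ball 0 1) (ball 0 1) := fun z hz => hΩ (hpΩ z hz)
  have hpeq : ∀ z ∈ ball (0 : ℂ) 1, ∀ ζ ∈ ball (0 : ℂ) 1, joukHat m h ζ = x z → p z = ζ :=
    fun z hz ζ hζ hzζ => joukHat_injOn hh (hpb hz) hζ (by rw [hpx z hz, hzζ])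
  have hpd : DifferentiableOn ℂ p (ball 0 1) := by
    intro z hz
    obtain ⟨F, hFd, hFz, hFx⟩ := exists_joukHat_lift hh (hmer z hz) (hpb hz) (hpx z hz).symm
    have h1 : F =ᶠ[𝓝 z] p := by
      filter_upwards [hFx, isOpen_ball.mem_nhds hz, hFd.continuousAt.eventually_mem
        (isOpen_ball.mem_nhds (by rw [hFz]; exact hpb hz))] with w h1 h2 h3
      exact (hpeq w h2 _ h3 h1).symm
    exact (h1.differentiableAt_iff.1 hFd).differentiableWithinAt
  have hpi : LocInj p := by
    intro z hz
    obtain ⟨U, hU, hUi⟩ := hinj z hz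
    refine ⟨U ∩ ball 0 1, inter_mem hU (isOpen_ball.mem_nhds hz), fun a ha b hb hab => ?_⟩
    exact hUi ha.1 hb.1 (by rw [← hpx a ha.2, ← hpx b hb.2, hab])
  have himp : p '' ball 0 1 = gapDomain m h e := by
    refine Subset.antisymm (image_subset_iff.2 hpΩ) fun ζ hζ => ?_
    have h1 : joukHat m h ζ ∈ x '' ball 0 1 := by rw [him]; exact mem_image_of_mem _ hζ
    obtain ⟨z, hz, hzζ⟩ := h1
    exact ⟨z, hz, hpeq z hz ζ (hΩ hζ) hzζ.symm⟩
  have hp0 : p 0 = 0 := hpeq 0 h0 0 h0 (by rw [joukHat_zero, hx0])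
  have hda : HasDerivAt p (deriv p 0) 0 :=
    (hpd.differentiableAt (isOpen_ball.mem_nhds h0)).hasDerivAt
  have hdne : deriv p 0 ≠ 0 := hpi.deriv_ne_zero hpd h0
  have hder : deriv p 0 = ((h / c : ℝ) : ℂ) := by
    have h1 : (h : ℂ) / deriv p 0 = c := by
      refine tendsto_nhds_unique (tendsto_mul_joukHat (m := m) hda hp0 hdne)
        (hlim.congr' ?_)
      filter_upwards [nhdsWithin_le_nhds (isOpen_ball.mem_nhds h0)] with z hz
      rw [hpx z hz]
    have hc' : (c : ℂ) ≠ 0 := by exact_mod_cast hc.ne'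
    push_cast
    rw [← h1]
    have hh' : (h : ℂ) ≠ 0 := by exact_mod_cast hh.ne'
    field_simp
  have hcov := discCover_of_isDiscAut hpd hpi fun z hz w hw hzw => by
    obtain ⟨g, hg⟩ := (hρ z hz w hw).1 (by rw [← hpx z hz, ← hpx w hw, hzw])
    refine ⟨ρ g, hρa g, hg, fun ζ hζ => ?_⟩
    have h1 := (hρa g).2.mapsTo hζ
    exact hpeq _ h1 _ (hpb hζ) (by rw [hpx ζ hζ]; exact (hρ ζ hζ _ h1).2 ⟨g, rfl⟩)
  rw [himp] at hcov
  exact ⟨p, hcov, himp, hp0, ⟨h / c, by positivity, hder ▸ hda⟩, hpx⟩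

lemma DiscCover.exists_lift_deriv {p p' : ℂ → ℂ} {Ω : Set ℂ} (hp' : DiscCover p' Ω)
    (hp : DifferentiableOn ℂ p (ball 0 1)) (hpΩ : MapsTo p (ball 0 1) Ω) (hp0 : p 0 = 0)
    (hp'0 : p' 0 = 0) {d d' : ℝ} (hd : HasDerivAt p d 0) (hd' : HasDerivAt p' d' 0) :
    ∃ F, DifferentiableOn ℂ F (ball 0 1) ∧ MapsTo F (ball 0 1) (ball 0 1) ∧
      (∀ z ∈ ball (0 : ℂ) 1, p' (F z) = p z) ∧ F 0 = 0 ∧ (d : ℂ) = d' * deriv F 0 ∧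
      ‖deriv F 0‖ ≤ 1 := by
  have h0 : (0 : ℂ) ∈ ball (0 : ℂ) 1 := mem_ball_self one_pos
  obtain ⟨F, hFd, hFm, hpF, hF0⟩ := hp'.exists_lift hp hpΩ h0 h0 (by rw [hp0, hp'0])
  refine ⟨F, hFd, hFm, hpF, hF0, ?_, ?_⟩
  · have h1 := (hFd.differentiableAt (isOpen_ball.mem_nhds h0)).hasDerivAt
    rw [← hF0] at hd'
    have h2 := hd'.comp (0 : ℂ) h1
    refine hd.unique (h2.congr_of_eventuallyEq ?_)
    filter_upwards [isOpen_ball.mem_nhds h0] with z hz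
    exact (hpF z hz).symm
  · refine Complex.norm_deriv_le_one_of_mapsTo_ball hFd ?_ one_pos
    rw [hF0]
    exact hFm.mono_right ball_subset_closedBall

/-- A normalized universal covering is unique. -/
lemma DiscCover.eqOn {p p' : ℂ → ℂ} {Ω : Set ℂ} (hp : DiscCover p Ω) (hp' : DiscCover p' Ω)
    (hpΩ : MapsTo p (ball 0 1) Ω) (hpΩ' : MapsTo p' (ball 0 1) Ω) (hp0 : p 0 = 0) (hp'0 : p' 0 = 0)
    {d d' : ℝ} (hd0 : 0 < d) (hd'0 : 0 < d') (hd : HasDerivAt p d 0) (hd' : HasDerivAt p' d' 0) :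
    EqOn p p' (ball 0 1) := by
  have hle : ∀ {a b : ℝ} {c : ℂ}, 0 < a → 0 < b → (a : ℂ) = b * c → ‖c‖ ≤ 1 → a ≤ b := by
    intro a b c ha hb habc hc
    have h1 := congrArg norm habc
    rw [norm_mul, Complex.norm_of_nonneg ha.le, Complex.norm_of_nonneg hb.le] at h1
    rw [h1]
    exact mul_le_of_le_one_right hb.le hc
  obtain ⟨F, hFd, hFm, hpF, hF0, hFder, hFn⟩ :=
    hp'.exists_lift_deriv hp.diff hpΩ hp0 hp'0 hd hd'
  obtain ⟨G, -, -, -, -, hGder, hGn⟩ := hp.exists_lift_deriv hp'.diff hpΩ' hp'0 hp0 hd' hd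
  have hdd : d = d' := le_antisymm (hle hd0 hd'0 hFder hFn) (hle hd'0 hd0 hGder hGn)
  have hF1 : deriv F 0 = 1 := by
    have h1 : (d' : ℂ) ≠ 0 := by exact_mod_cast hd'0.ne'
    rw [hdd] at hFder
    exact mul_left_cancel₀ h1 (by rw [← hFder, mul_one])
  have h0 : (0 : ℂ) ∈ ball (0 : ℂ) 1 := mem_ball_self one_pos
  obtain ⟨C, -, hC⟩ := Complex.affine_of_mapsTo_ball_of_exists_norm_dslope_eq_div' (R₂ := 1) hFd
    (by rw [hF0]; exact hFm.mono_right ball_subset_closedBall)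
    ⟨0, h0, by rw [dslope_same, hF1]; simp⟩
  have hC1 : C = 1 := by
    have h1 : HasDerivAt (fun z : ℂ => F 0 + (z - 0) • C) C 0 := by
      simpa using ((hasDerivAt_id (0 : ℂ)).mul_const C).const_add (F 0)
    rw [← hF1, ← h1.deriv]
    refine Filter.EventuallyEq.deriv_eq ?_
    filter_upwards [isOpen_ball.mem_nhds h0] with z hz
    exact (hC hz).symm
  intro z hz
  have h1 : F z = z := by
    rw [hC hz, hC1, hF0]; simp
  rw [← hpF z hz, h1]

lemma exists_isFGCoveringMap {l : ℕ} {e : Set ℝ} {m h : ℝ} (hh : 0 < h)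
    (he : Icc (m - 2 * h) (m + 2 * h) ⊆ e) {p : ℂ → ℂ} (hp : DiscCover p (gapDomain m h e))
    (hpim : p '' ball 0 1 = gapDomain m h e) (hp0 : p 0 = 0) {d : ℝ} (hd0 : 0 < d)
    (hd : HasDerivAt p d 0) {ρ : FreeGroup (Fin l) →* (Disc ≃ₜ Disc)} (hρd : ∀ g, IsDeck p (ρ g))
    (hρi : Function.Injective ρ) (hρ : ∀ z w : Disc, p z = p w → ∃ g, ρ g z = w) :
    IsFGCoveringMap l e (fun z => joukHat m h (p z)) := by
  classical
  have hpb : MapsTo p (ball 0 1) (ball 0 1) := fun z hz =>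
    (hpim ▸ mem_image_of_mem p hz : p z ∈ gapDomain m h e).1
  let σ : FreeGroup (Fin l) → ℂ → ℂ := fun g z => if hz : z ∈ ball (0 : ℂ) 1 then ρ g ⟨z, hz⟩ else z
  have hσ : ∀ g, ∀ z (hz : z ∈ ball (0 : ℂ) 1), σ g z = ρ g ⟨z, hz⟩ := fun g z hz => dif_pos hz
  have hσm : ∀ g, MapsTo (σ g) (ball 0 1) (ball 0 1) := fun g z hz => by
    rw [hσ g z hz]; exact (ρ g ⟨z, hz⟩).2
  have hσp : ∀ g, ∀ z ∈ ball (0 : ℂ) 1, p (σ g z) = p z := fun g z hz => by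
    rw [hσ g z hz]; exact hρd g ⟨z, hz⟩
  have hσ1 : ∀ z ∈ ball (0 : ℂ) 1, σ 1 z = z := fun z hz => by
    rw [hσ 1 z hz, map_one]; rfl
  have hσmul : ∀ g k, ∀ z ∈ ball (0 : ℂ) 1, σ (g * k) z = σ g (σ k z) := fun g k z hz => by
    rw [hσ g _ (hσm k hz), hσ _ z hz, map_mul]
    simp only [hσ k z hz]
    rfl
  have hσinv : ∀ g, ∀ z ∈ ball (0 : ℂ) 1, σ g (σ g⁻¹ z) = z := fun g z hz => by
    rw [← hσmul g _ z hz, mul_inv_cancel, hσ1 z hz]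
  refine ⟨fun z hz => meroSphereAt_joukHat_comp hh (hp.diff.analyticAt (isOpen_ball.mem_nhds hz)),
    ?_, fun z hz => ?_, by simp only [hp0, joukHat_zero], ⟨h / d, by positivity, ?_⟩, σ,
    fun g => ?_, hσ1, hσmul, fun g k hgk => ?_, fun z hz w hw => ⟨fun hzw => ?_, ?_⟩⟩
  · rw [← image_joukHat hh he, ← hpim, image_image]
  · obtain ⟨N, hN, hNi⟩ := hp.inj z hz
    refine ⟨N ∩ ball 0 1, inter_mem hN (isOpen_ball.mem_nhds hz), fun a ha b hb hab => ?_⟩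
    exact hNi ha.1 hb.1 (joukHat_injOn hh (hpb ha.2) (hpb hb.2) hab)
  · have h1 := tendsto_mul_joukHat (m := m) (h := h) hd hp0 (by exact_mod_cast hd0.ne')
    exact_mod_cast h1
  · refine ⟨hp.inj.differentiableOn_lift hp.diff isOpen_ball hp.diff ?_ (hσm g) (hσp g), hσm g, ?_,
      fun z hz => ⟨σ g⁻¹ z, hσm _ hz, hσinv g z hz⟩⟩
    · rw [continuousOn_iff_continuous_domRestrict]
      have h1 : Continuous fun z : Disc => (ρ g z : ℂ) :=
        continuous_subtype_val.comp (ρ g).continuous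
      exact h1.congr fun z => (hσ g z z.2).symm
    · intro a ha b hb hab
      have h1 := congrArg (σ g⁻¹) hab
      rwa [← hσmul _ _ a ha, ← hσmul _ _ b hb, inv_mul_cancel, hσ1 a ha, hσ1 b hb] at h1
  · refine hρi (Homeomorph.ext fun z => Subtype.ext ?_)
    have h1 := hgk z.2
    rwa [hσ g z z.2, hσ k z z.2] at h1
  · obtain ⟨g, hg⟩ := hρ ⟨z, hz⟩ ⟨w, hw⟩ (joukHat_injOn hh (hpb hz) (hpb hw) hzw)
    exact ⟨g, by rw [hσ g z hz, hg]⟩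
  · rintro ⟨g, rfl⟩
    simp only [hσp g z hz]

end FGCover

/-- Existence and uniqueness of the covering map of Theorem 3.1. -/
theorem covering_map_exists_unique
    (l : ℕ) (e : Set ℝ) (he : IsFiniteGapSetWith l e) :
    ∃ x : ℂ → OnePoint ℂ, IsFGCoveringMap l e x ∧
      ∀ x' : ℂ → OnePoint ℂ, IsFGCoveringMap l e x' →
        Set.EqOn x x' (Metric.ball (0 : ℂ) 1) := by
  obtain ⟨α, β, hαβ, hβα, he'⟩ := he
  have hh : 0 < (β 0 - α 0) / 4 := by linarith [hαβ 0]
  have hsub : Icc ((α 0 + β 0) / 2 - 2 * ((β 0 - α 0) / 4))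
      ((α 0 + β 0) / 2 + 2 * ((β 0 - α 0) / 4)) ⊆ e := by
    rw [he']
    refine subset_iUnion_of_subset 0 (Icc_subset_Icc ?_ ?_) <;> linarith
  obtain ⟨p, hp, hpim, hp0, ⟨d, hd0, hd⟩, ρ, hρd, hρi, hρ⟩ :=
    FGCover.exists_gapDomain_cover hαβ hβα rfl rfl he'
  refine ⟨_, FGCover.exists_isFGCoveringMap hh hsub hp hpim hp0 hd0 hd hρd hρi hρ,
    fun x' hx' z hz => ?_⟩
  obtain ⟨p', hp', hpim', hp'0, ⟨d', hd'0, hd'⟩, hpx'⟩ :=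
    FGCover.exists_joukHat_factor hx' hh hsub
  rw [← hpx' z hz]
  exact congrArg _ (hp.eqOn hp' (mapsTo_iff_image_subset.2 hpim.subset)
    (mapsTo_iff_image_subset.2 hpim'.subset) hp0 hp'0 hd0 hd'0 hd hd' hz)
end
end

section
/- Let {a_n}_{n=1}^∞ and {b_n}_{n=1}^∞ be bounded sequences with a_n > 0, b_n ∈ ℝ, set a_0 = 1, let μ be the associated measure, and let z ∈ ℂ with z ∉ σ_ess(μ). Then the complex vector space of square-summable sequences (u_n)_{n=0}^∞ (∑_{n=0}^∞ |u_n|² < ∞) satisfying the difference equation a_{n−1}u_{n−1} + b_n u_n + a_n u_{n+1} = z·u_n for all n ≥ 1 is exactly one-dimensional; that is, the ℓ² solution is unique up to a multiplicative constant. -/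
open MeasureTheory Filter Set Metric

noncomputable section

/-- The (topological) support of a measure: points all of whose neighborhoods
have positive measure. -/
def msupport {X : Type*} [TopologicalSpace X] [MeasurableSpace X] (μ : Measure X) : Set X :=
  {x | ∀ U ∈ nhds x, 0 < μ U}

/-- The essential spectrum of a measure: the accumulation points of its support. -/
def essSpec (μ : Measure ℝ) : Set ℝ := {x | AccPt x (Filter.principal (msupport μ))}

/-- `a b : ℕ → ℝ` (indexed from 1; index 0 unused) are the Jacobi parameters of the
measure `μ`: there is a family of orthonormal polynomials `p n` of degree `n` with
positive leading coefficients satisfying the three-term recursion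
`x pₙ = a_{n+1} p_{n+1} + b_{n+1} pₙ + aₙ p_{n-1}` (with `p_{-1} = 0`). -/
def IsJacobiParams (μ : Measure ℝ) (a b : ℕ → ℝ) : Prop :=
  ∃ p : ℕ → Polynomial ℝ,
    (∀ n, (p n).natDegree = n) ∧
    (∀ n, 0 < (p n).leadingCoeff) ∧
    (∀ m n, ∫ x, (p m).eval x * (p n).eval x ∂μ = if m = n then 1 else 0) ∧
    (∀ n : ℕ, ∀ x : ℝ,
      x * (p n).eval x =
        a (n + 1) * (p (n + 1)).eval x + b (n + 1) * (p n).eval x +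
          (if n = 0 then 0 else a n * (p (n - 1)).eval x))

/-- The a.c. density `w` of a measure on `ℝ` (w.r.t. Lebesgue measure). -/
def densityOf (μ : Measure ℝ) : ℝ → ℝ := fun x => (μ.rnDeriv volume x).toReal

theorem measure_compl_msupport (μ : Measure ℝ) : μ (msupport μ)ᶜ = 0 := by
  refine measure_null_of_locally_null _ fun x hx => ?_
  simp only [msupport, mem_compl_iff, mem_ofPred_eq, not_forall, not_lt, nonpos_iff_eq_zero] at hx
  obtain ⟨U, hU, h0⟩ := hx
  exact ⟨U, mem_nhdsWithin_of_mem_nhds hU, h0⟩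

/-- An isolated point of the support carries positive mass. -/
theorem measure_singleton_pos_of_notMem_essSpec {μ : Measure ℝ} {x : ℝ}
    (hx : x ∈ msupport μ) (hess : x ∉ essSpec μ) : 0 < μ {x} := by
  rw [essSpec, mem_ofPred_eq, accPt_iff_nhds] at hess
  push Not at hess
  obtain ⟨U, hU, h⟩ := hess
  have hsub : U ⊆ {x} ∪ (msupport μ)ᶜ := fun y hy => by
    by_cases hyS : y ∈ msupport μ
    · exact Or.inl (h y ⟨hy, hyS⟩)
    · exact Or.inr hyS
  calc 0 < μ U := hx U hU
    _ ≤ μ ({x} ∪ (msupport μ)ᶜ) := measure_mono hsub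
    _ ≤ μ {x} + μ (msupport μ)ᶜ := measure_union_le _ _
    _ = μ {x} := by rw [measure_compl_msupport, add_zero]

theorem memLp_polynomial {μ : Measure ℝ} [IsFiniteMeasure μ] (hcpt : IsCompact (msupport μ))
    (q : Polynomial ℝ) : MemLp (fun x => ((q.eval x : ℝ) : ℂ)) 2 μ := by
  have hc : Continuous fun x => ((q.eval x : ℝ) : ℂ) :=
    Complex.continuous_ofReal.comp q.continuous
  obtain ⟨K, hK⟩ := hcpt.exists_bound_of_continuousOn hc.continuousOn
  refine MemLp.of_bound hc.aestronglyMeasurable K ?_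
  filter_upwards [measure_eq_zero_iff_ae_notMem.1 (measure_compl_msupport μ)] with x hx
  exact hK x (not_not.1 hx)

/-- Bessel's inequality for orthonormal polynomials. -/
theorem summable_sq_norm_integral_mul {μ : Measure ℝ} [IsFiniteMeasure μ]
    (hcpt : IsCompact (msupport μ)) {p : ℕ → Polynomial ℝ}
    (horth : ∀ m n, ∫ x, (p m).eval x * (p n).eval x ∂μ = if m = n then 1 else 0)
    {φ : ℝ → ℂ} (hφ : MemLp φ 2 μ) :
    Summable fun n => ‖∫ x, (((p n).eval x : ℝ) : ℂ) * φ x ∂μ‖ ^ 2 := by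
  let e : ℕ → Lp ℂ 2 μ := fun n => (memLp_polynomial hcpt (p n)).toLp _
  have he : ∀ n, e n =ᵐ[μ] fun x => (((p n).eval x : ℝ) : ℂ) := fun n => MemLp.coeFn_toLp _
  have hon : Orthonormal ℂ e := by
    rw [orthonormal_iff_ite]
    intro m n
    rw [L2.inner_def]
    have : ∫ x, inner ℂ (e m x) (e n x) ∂μ
        = ∫ x, (((p m).eval x * (p n).eval x : ℝ) : ℂ) ∂μ := by
      refine integral_congr_ae ?_
      filter_upwards [he m, he n] with x hm hn
      simp [hm, hn, mul_comm]
    rw [this, integral_complex_ofReal, horth]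
    split_ifs <;> simp
  refine (hon.inner_products_summable (hφ.toLp φ)).congr fun n => ?_
  rw [L2.inner_def]
  congr 2
  refine integral_congr_ae ?_
  filter_upwards [he n, hφ.coeFn_toLp] with x hn hx
  simp [hn, hx, mul_comm]

/-- A function `φ ∈ L²(μ)` with `(x - z) φ(x) = c` almost everywhere yields a square-summable
solution of the Jacobi difference equation. -/
theorem square_summable_solution {μ : Measure ℝ} [IsProbabilityMeasure μ]
    (hcpt : IsCompact (msupport μ)) {a b : ℕ → ℝ} (ha0 : a 0 = 1) {p : ℕ → Polynomial ℝ}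
    (hp0 : p 0 = 1)
    (horth : ∀ m n, ∫ x, (p m).eval x * (p n).eval x ∂μ = if m = n then 1 else 0)
    (hrec : ∀ n : ℕ, ∀ x : ℝ,
      x * (p n).eval x =
        a (n + 1) * (p (n + 1)).eval x + b (n + 1) * (p n).eval x +
          (if n = 0 then 0 else a n * (p (n - 1)).eval x))
    {φ : ℝ → ℂ} (hφ : MemLp φ 2 μ) {z c : ℂ} (hc : ∀ᵐ x : ℝ ∂μ, ((x : ℂ) - z) * φ x = c)
    {u : ℕ → ℂ} (hu0 : u 0 = -c) (hu : ∀ n, u (n + 1) = ∫ x, (((p n).eval x : ℝ) : ℂ) * φ x ∂μ) :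
    (Summable fun n => ‖u n‖ ^ 2) ∧
      ∀ n, 1 ≤ n →
        (a (n - 1) : ℂ) * u (n - 1) + (b n : ℂ) * u n + (a n : ℂ) * u (n + 1) = z * u n := by
  constructor
  · rw [← summable_nat_add_iff 1]
    simpa only [hu] using summable_sq_norm_integral_mul hcpt horth hφ
  have hint : ∀ n, Integrable (fun x => (((p n).eval x : ℝ) : ℂ) * φ x) μ := fun n =>
    (memLp_polynomial hcpt (p n)).integrable_mul hφ
  have hpint : ∀ n, Integrable (fun x => (((p n).eval x : ℝ) : ℂ)) μ := fun n =>
    (memLp_polynomial hcpt (p n)).integrable (by norm_num)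
  have hmean : ∀ n, ∫ x, (((p n).eval x : ℝ) : ℂ) ∂μ = if n = 0 then 1 else 0 := fun n => by
    rw [integral_complex_ofReal]
    have := horth n 0
    simp only [hp0, Polynomial.eval_one, mul_one] at this
    rw [this]
    split_ifs <;> simp
  have key : ∀ n, ∫ x, (x : ℂ) * ((((p n).eval x : ℝ) : ℂ) * φ x) ∂μ
      = z * u (n + 1) + c * (if n = 0 then 1 else 0) := fun n => by
    rw [hu, ← hmean n, ← integral_const_mul, ← integral_const_mul,
      ← integral_add ((hint n).const_mul z) ((hpint n).const_mul c)]
    refine integral_congr_ae ?_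
    filter_upwards [hc] with x hx
    linear_combination (((p n).eval x : ℝ) : ℂ) * hx
  intro n hn
  obtain ⟨n, rfl⟩ := Nat.exists_eq_add_of_le' hn
  rw [Nat.add_sub_cancel]
  rcases n with _ | n
  · have h := key 0
    have h' : ∫ x, (x : ℂ) * ((((p 0).eval x : ℝ) : ℂ) * φ x) ∂μ = a 1 * u 2 + b 1 * u 1 := by
      rw [hu, hu, ← integral_const_mul, ← integral_const_mul,
        ← integral_add ((hint 1).const_mul _) ((hint 0).const_mul _)]
      congr 1 with x
      have := congrArg Complex.ofReal (hrec 0 x)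
      push_cast [if_pos] at this
      rw [add_zero] at this
      linear_combination φ x * this
    rw [h'] at h
    simp only [if_true, zero_add] at h ⊢
    rw [hu0, ha0]
    push_cast
    linear_combination h
  · have h := key (n + 1)
    have h' : ∫ x, (x : ℂ) * ((((p (n + 1)).eval x : ℝ) : ℂ) * φ x) ∂μ
        = a (n + 2) * u (n + 3) + b (n + 2) * u (n + 2) + a (n + 1) * u (n + 1) := by
      rw [hu, hu, hu, ← integral_const_mul, ← integral_const_mul, ← integral_const_mul,
        ← integral_add ((hint _).const_mul _) ((hint _).const_mul _),
        ← integral_add (((hint _).const_mul _).fun_add ((hint _).const_mul _))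
          ((hint _).const_mul _)]
      congr 1 with x
      have := congrArg Complex.ofReal (hrec (n + 1) x)
      rw [if_neg (Nat.succ_ne_zero n), Nat.add_sub_cancel] at this
      push_cast at this
      linear_combination φ x * this
    rw [h', if_neg (Nat.succ_ne_zero n)] at h
    linear_combination h

/-- A solution of the Jacobi difference equation with vanishing initial data is zero. -/
theorem solution_eq_zero {a b : ℕ → ℝ} (hpos : ∀ n, 1 ≤ n → 0 < a n) {z : ℂ} {w : ℕ → ℂ}
    (hw : ∀ n, 1 ≤ n →
      (a (n - 1) : ℂ) * w (n - 1) + (b n : ℂ) * w n + (a n : ℂ) * w (n + 1) = z * w n)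
    (h0 : w 0 = 0) (h1 : w 1 = 0) : w = 0 := by
  have : ∀ n, w n = 0 ∧ w (n + 1) = 0 := fun n => by
    induction n with
    | zero => exact ⟨h0, h1⟩
    | succ n ih =>
      refine ⟨ih.2, ?_⟩
      have h := hw (n + 1) (by omega)
      rw [Nat.add_sub_cancel, ih.1, ih.2] at h
      have ha : (a (n + 1) : ℂ) ≠ 0 := by exact_mod_cast (hpos (n + 1) (by omega)).ne'
      simpa [ha] using h
  exact funext fun n => (this n).1

/-- The Wronskian of two square-summable solutions vanishes. -/
theorem wronskian_eq_zero {a b : ℕ → ℝ} (ha0 : a 0 = 1) {C : ℝ} (hC : ∀ n, |a n| ≤ C)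
    {z : ℂ} {u v : ℕ → ℂ} (hus : Summable fun n => ‖u n‖ ^ 2)
    (hu : ∀ n, 1 ≤ n →
      (a (n - 1) : ℂ) * u (n - 1) + (b n : ℂ) * u n + (a n : ℂ) * u (n + 1) = z * u n)
    (hvs : Summable fun n => ‖v n‖ ^ 2)
    (hv : ∀ n, 1 ≤ n →
      (a (n - 1) : ℂ) * v (n - 1) + (b n : ℂ) * v n + (a n : ℂ) * v (n + 1) = z * v n) :
    u 1 * v 0 = u 0 * v 1 := by
  have tendsto_zero : ∀ w : ℕ → ℂ, (Summable fun n => ‖w n‖ ^ 2) → Tendsto w atTop (nhds 0) := by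
    intro w hw
    rw [tendsto_zero_iff_norm_tendsto_zero]
    simpa using hw.tendsto_atTop_zero.sqrt
  have hu0 := tendsto_zero u hus
  have hv0 := tendsto_zero v hvs
  have hconst : ∀ n, (a n : ℂ) * (u (n + 1) * v n - u n * v (n + 1)) = u 1 * v 0 - u 0 * v 1 := by
    intro n
    induction n with
    | zero => simp [ha0]
    | succ n ih =>
      have h1 := hu (n + 1) (by omega)
      have h2 := hv (n + 1) (by omega)
      rw [Nat.add_sub_cancel] at h1 h2
      linear_combination ih + v (n + 1) * h1 - u (n + 1) * h2
  have hlim : Tendsto (fun n => u (n + 1) * v n - u n * v (n + 1)) atTop (nhds 0) := by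
    simpa using (((tendsto_add_atTop_iff_nat 1).2 hu0).mul hv0).sub
      (hu0.mul ((tendsto_add_atTop_iff_nat 1).2 hv0))
  have hlim' := isBoundedUnder_le_mul_tendsto_zero (f := fun n => (a n : ℂ))
    (isBoundedUnder_of ⟨C, fun n => by simpa using hC n⟩) hlim
  simp only [hconst] at hlim'
  exact sub_eq_zero.1 (tendsto_nhds_unique tendsto_const_nhds hlim')

theorem exists_eq_smul_of_square_summable {a b : ℕ → ℝ} (ha0 : a 0 = 1)
    (hpos : ∀ n, 1 ≤ n → 0 < a n) {C : ℝ} (hC : ∀ n, |a n| ≤ C)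
    {z : ℂ} {u v : ℕ → ℂ} (hus : Summable fun n => ‖u n‖ ^ 2)
    (hu : ∀ n, 1 ≤ n →
      (a (n - 1) : ℂ) * u (n - 1) + (b n : ℂ) * u n + (a n : ℂ) * u (n + 1) = z * u n)
    (hne : u ≠ 0) (hvs : Summable fun n => ‖v n‖ ^ 2)
    (hv : ∀ n, 1 ≤ n →
      (a (n - 1) : ℂ) * v (n - 1) + (b n : ℂ) * v n + (a n : ℂ) * v (n + 1) = z * v n) :
    ∃ c : ℂ, v = c • u := by
  have hW := wronskian_eq_zero ha0 hC hus hu hvs hv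
  obtain ⟨c, h0, h1⟩ : ∃ c : ℂ, v 0 = c * u 0 ∧ v 1 = c * u 1 := by
    by_cases h0 : u 0 = 0
    · have h1 : u 1 ≠ 0 := fun h1 => hne (solution_eq_zero hpos hu h0 h1)
      refine ⟨v 1 / u 1, ?_, by field_simp⟩
      field_simp
      linear_combination hW
    · refine ⟨v 0 / u 0, by field_simp, ?_⟩
      field_simp
      linear_combination -hW
  refine ⟨c, sub_eq_zero.1 (solution_eq_zero (b := b) (z := z) hpos (fun n hn => ?_) ?_ ?_)⟩
  · simp only [Pi.sub_apply, Pi.smul_apply, smul_eq_mul]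
    linear_combination hv n hn - c * hu n hn
  · simp [h0]
  · simp [h1]

/-- For `z` outside the essential spectrum, the space of ℓ² solutions of the
Jacobi difference equation is exactly one-dimensional (Theorem 5.2 (iv)). -/
theorem jost_solution_unique
    (a b : ℕ → ℝ) (ha0 : a 0 = 1) (hpos : ∀ n, 1 ≤ n → 0 < a n)
    (hbdd : ∃ C : ℝ, ∀ n, |a n| + |b n| ≤ C)
    (μ : Measure ℝ) (hprob : IsProbabilityMeasure μ)
    (hcpt : IsCompact (msupport μ)) (hinf : (msupport μ).Infinite)
    (hJ : IsJacobiParams μ a b)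
    (z : ℂ) (hz : z ∉ Complex.ofReal '' essSpec μ) :
    ∃ u : ℕ → ℂ,
      (Summable fun n => ‖u n‖ ^ 2) ∧
      (∀ n, 1 ≤ n →
        (a (n - 1) : ℂ) * u (n - 1) + (b n : ℂ) * u n + (a n : ℂ) * u (n + 1) = z * u n) ∧
      u ≠ 0 ∧
      ∀ v : ℕ → ℂ,
        (Summable fun n => ‖v n‖ ^ 2) →
        (∀ n, 1 ≤ n →
          (a (n - 1) : ℂ) * v (n - 1) + (b n : ℂ) * v n + (a n : ℂ) * v (n + 1) = z * v n) →
        ∃ c : ℂ, v = c • u := by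
  obtain ⟨C, hC⟩ := hbdd
  have hC' : ∀ n, |a n| ≤ C := fun n => le_trans (le_add_of_nonneg_right (abs_nonneg _)) (hC n)
  suffices h : ∃ u : ℕ → ℂ, (Summable fun n => ‖u n‖ ^ 2) ∧
      (∀ n, 1 ≤ n →
        (a (n - 1) : ℂ) * u (n - 1) + (b n : ℂ) * u n + (a n : ℂ) * u (n + 1) = z * u n) ∧
      u ≠ 0 by
    obtain ⟨u, hus, hu, hne⟩ := h
    exact ⟨u, hus, hu, hne, fun v hvs hv =>
      exists_eq_smul_of_square_summable ha0 hpos hC' hus hu hne hvs hv⟩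
  obtain ⟨p, hdeg, hlead, horth, hrec⟩ := hJ
  have hp0 : p 0 = 1 := by
    have hconst := Polynomial.eq_C_of_natDegree_eq_zero (hdeg 0)
    have hl := hlead 0
    have h := horth 0 0
    rw [hconst] at h hl ⊢
    simp only [Polynomial.eval_C, integral_const, probReal_univ, one_smul, if_true,
      Polynomial.leadingCoeff_C] at h hl
    rcases mul_self_eq_one_iff.1 h with h | h
    · rw [h, Polynomial.C_1]
    · linarith
  by_cases hzS : z ∈ Complex.ofReal '' msupport μ
  · obtain ⟨x₀, hx₀, rfl⟩ := hzS
    have hmass := measure_singleton_pos_of_notMem_essSpec hx₀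
      fun h => hz (mem_image_of_mem _ h)
    let φ : ℝ → ℂ := Set.indicator {x₀} fun _ => 1
    have hφ : MemLp φ 2 μ := (memLp_const (1 : ℂ)).indicator (measurableSet_singleton x₀)
    have hc : ∀ᵐ x : ℝ ∂μ, ((x : ℂ) - x₀) * φ x = 0 := .of_forall fun x => by
      by_cases hx : x = x₀ <;> simp [φ, hx]
    let u : ℕ → ℂ := fun n => Nat.casesOn n 0 fun n => ∫ x, (((p n).eval x : ℝ) : ℂ) * φ x ∂μ
    obtain ⟨hs, hu⟩ := square_summable_solution (u := u) hcpt ha0 hp0 horth hrec hφ hc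
      (by simp [u]) fun n => rfl
    refine ⟨u, hs, hu, fun h => ?_⟩
    have h1 : ∫ x, (((p 0).eval x : ℝ) : ℂ) * φ x ∂μ = 0 := congrFun h 1
    have hreal : μ.real {x₀} = 0 := by
      have hint := integral_indicator_const (μ := μ) (1 : ℂ) (measurableSet_singleton x₀)
      simp only [hp0, Polynomial.eval_one, Complex.ofReal_one, one_mul] at h1
      rw [h1] at hint
      simpa using hint.symm
    rw [measureReal_eq_zero_iff] at hreal
    exact hmass.ne' hreal
  · have hclosed : IsClosed (Complex.ofReal '' msupport μ) :=
      (hcpt.image Complex.continuous_ofReal).isClosed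
    obtain ⟨δ, hδ, hball⟩ := Metric.isOpen_iff.1 hclosed.isOpen_compl z hzS
    have hdist : ∀ᵐ x : ℝ ∂μ, δ ≤ ‖(x : ℂ) - z‖ := by
      filter_upwards [measure_eq_zero_iff_ae_notMem.1 (measure_compl_msupport μ)] with x hx
      by_contra! hlt
      exact hball (mem_ball_iff_norm.2 hlt) (mem_image_of_mem _ (not_not.1 hx))
    let φ : ℝ → ℂ := fun x => ((x : ℂ) - z)⁻¹
    have hφ : MemLp φ 2 μ := by
      refine MemLp.of_bound
        (Complex.measurable_ofReal.sub_const z).inv.aestronglyMeasurable δ⁻¹ ?_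
      filter_upwards [hdist] with x hx
      rw [norm_inv]
      exact inv_anti₀ hδ hx
    have hc : ∀ᵐ x : ℝ ∂μ, ((x : ℂ) - z) * φ x = 1 := by
      filter_upwards [hdist] with x hx
      exact mul_inv_cancel₀ (norm_pos_iff.1 (hδ.trans_le hx))
    let u : ℕ → ℂ := fun n => Nat.casesOn n (-1) fun n => ∫ x, (((p n).eval x : ℝ) : ℂ) * φ x ∂μ
    obtain ⟨hs, hu⟩ := square_summable_solution (u := u) hcpt ha0 hp0 horth hrec hφ hc
      rfl fun n => rfl
    refine ⟨u, hs, hu, fun h => ?_⟩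
    have h0 : (-1 : ℂ) = 0 := congrFun h 0
    norm_num at h0
end
end
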